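/- Let q > 2 be a prime power, d = gcd(3, q−1), and H = PSL₃(F_q). If a subgroup M of H contains an element of order (q² + q + 1)/d and an element of order (q² − 1)/d, then M = H. -/

import Mathlib

open scoped MatrixGroups

/-- `Σ(T)`: the union of all conjugates of the cyclic subgroups generated by the
three entries of the triple `T = (a, b, c)`. -/
def SigmaSet {G : Type*} [Group G] (T : G × G × G) : Set G :=
  {x | ∃ g : G, g * x * g⁻¹ ∈
    (Subgroup.zpowers T.1 : Set G) ∪ (Subgroup.zpowers T.2.1 : Set G) ∪
      (Subgroup.zpowers T.2.2 : Set G)}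

/-- `T = (a,b,c)` is a generating triple: `a*b*c = 1` and `{a,b,c}` generates. -/
def IsGenTriple {G : Type*} [Group G] (T : G × G × G) : Prop :=
  T.1 * T.2.1 * T.2.2 = 1 ∧ Subgroup.closure {T.1, T.2.1, T.2.2} = ⊤

/-- `T` is hyperbolic: the reciprocals of the orders of its entries sum to less than 1. -/
def IsHyperbolic {G : Type*} [Group G] (T : G × G × G) : Prop :=
  (orderOf T.1 : ℚ)⁻¹ + (orderOf T.2.1 : ℚ)⁻¹ + (orderOf T.2.2 : ℚ)⁻¹ < 1

/-- An unmixed Beauville structure on `G`: a pair of hyperbolic generating triples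
`T₁, T₂` with `Σ(T₁) ∩ Σ(T₂) = {1}`. -/
def HasBeauvilleStructure (G : Type*) [Group G] : Prop :=
  ∃ T₁ T₂ : G × G × G, IsGenTriple T₁ ∧ IsHyperbolic T₁ ∧ IsGenTriple T₂ ∧ IsHyperbolic T₂ ∧
    SigmaSet T₁ ∩ SigmaSet T₂ = {1}

/-- `φ₂(H)`: the number of ordered generating pairs of `H`. -/
noncomputable def phi2 (H : Type*) [Group H] : ℕ :=
  Nat.card {p : H × H // Subgroup.closure {p.1, p.2} = ⊤}

/-- Two triples are equivalent if some automorphism carries one to the other entrywise. -/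
def TripleEquiv {H : Type*} [Group H] (T T' : H × H × H) : Prop :=
  ∃ α : MulAut H, α T.1 = T'.1 ∧ α T.2.1 = T'.2.1 ∧ α T.2.2 = T'.2.2

theorem gcd_three_eq_one_or_three (m : ℕ) : Nat.gcd 3 m = 1 ∨ Nat.gcd 3 m = 3 :=
  (Nat.dvd_prime Nat.prime_three).1 (Nat.gcd_dvd_left 3 m)

theorem gcd_three_pred_dvd (q : ℕ) (hq : 1 ≤ q) : Nat.gcd 3 (q - 1) ∣ q ^ 2 + q + 1 := by
  obtain ⟨t, rfl⟩ := Nat.exists_eq_add_of_le hq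
  rcases gcd_three_eq_one_or_three (1 + t - 1) with h | h
  · rw [h]; exact one_dvd _
  · have h3 := Nat.gcd_dvd_right 3 (1 + t - 1)
    rw [h] at h3 ⊢
    obtain ⟨s, hs⟩ := h3
    have : t = 3 * s := by omega
    subst this
    exact ⟨3 * s ^ 2 + 3 * s + 1, by ring⟩

theorem sq_sub_one_eq (q : ℕ) : q ^ 2 - 1 = (q - 1) * (q + 1) := by
  rw [mul_comm]; simpa using Nat.sq_sub_sq q 1

theorem cube_sub_one_eq (q : ℕ) (hq : 1 ≤ q) : q ^ 3 - 1 = (q - 1) * (q ^ 2 + q + 1) := by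
  obtain ⟨t, rfl⟩ := Nat.exists_eq_add_of_le hq
  simp only [Nat.add_sub_cancel_left]
  apply Nat.sub_eq_of_eq_add
  ring

theorem gcd_three_pred_dvd_sq_sub_one (q : ℕ) : Nat.gcd 3 (q - 1) ∣ q ^ 2 - 1 := by
  rw [sq_sub_one_eq]
  exact (Nat.gcd_dvd_right 3 (q - 1)).mul_right _

/-- A prime dividing `(q² + q + 1) / gcd(3, q - 1)` divides neither `q`, `q - 1` nor `q + 1`. -/
theorem prime_not_dvd_of_dvd_singer {q n r : ℕ} (hq : 1 ≤ q)
    (hn : Nat.gcd 3 (q - 1) * n = q ^ 2 + q + 1) (hr : r.Prime) (hrn : r ∣ n) :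
    ¬ r ∣ q ∧ ¬ r ∣ q - 1 ∧ ¬ r ∣ q + 1 := by
  have hrs : r ∣ q ^ 2 + q + 1 := hn ▸ hrn.mul_left _
  refine ⟨fun h => ?_, fun h => ?_, fun h => ?_⟩
  · have : r ∣ q * (q + 1) := h.mul_right _
    rw [show q ^ 2 + q + 1 = q * (q + 1) + 1 by ring] at hrs
    exact hr.one_lt.ne' (Nat.dvd_one.1 ((Nat.dvd_add_right this).1 hrs))
  · obtain ⟨t, rfl⟩ := Nat.exists_eq_add_of_le hq
    simp only [Nat.add_sub_cancel_left] at h hn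
    have h3 : r ∣ 3 := by
      have : r ∣ t * (t + 3) := h.mul_right _
      rw [show (1 + t) ^ 2 + (1 + t) + 1 = t * (t + 3) + 3 by ring] at hrs
      exact (Nat.dvd_add_right this).1 hrs
    have hr3 : r = 3 := (Nat.prime_dvd_prime_iff_eq hr Nat.prime_three).1 h3
    subst hr3
    rw [Nat.gcd_eq_left h] at hn
    obtain ⟨s, rfl⟩ := h
    obtain ⟨m, rfl⟩ := hrn
    have : 9 * m = 9 * (s ^ 2 + s) + 3 := by nlinarith
    omega
  · have : r ∣ q * (q + 1) := h.mul_left _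
    rw [show q ^ 2 + q + 1 = q * (q + 1) + 1 by ring] at hrs
    exact hr.one_lt.ne' (Nat.dvd_one.1 ((Nat.dvd_add_right this).1 hrs))

theorem coprime_gcd_three_pred_succ (q : ℕ) (hq : 1 ≤ q) :
    Nat.Coprime (Nat.gcd 3 (q - 1)) (q + 1) := by
  rcases gcd_three_eq_one_or_three (q - 1) with h | h
  · rw [h]; exact Nat.coprime_one_left _
  · have h3 := Nat.gcd_dvd_right 3 (q - 1)
    rw [h] at h3 ⊢
    rw [Nat.Prime.coprime_iff_not_dvd Nat.prime_three]
    omega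

theorem no_invariant_set_card {q N k ε₁ ε₂ : ℕ} (hq : 4 ≤ q) (hN : 3 * N = q ^ 2 - 1)
    (h₁ : ε₁ = 0 ∨ ε₁ = 1) (h₂ : ε₂ = 0 ∨ ε₂ = q + 1)
    (h : 3 * (ε₁ + ε₂ + k * N) = q ^ 2 + q + 1) : False := by
  have hsq : 3 * N + 1 = q ^ 2 := by
    have : 1 ≤ q ^ 2 := Nat.one_le_pow _ _ (by omega)
    omega
  have hq4 : 4 * q ≤ q ^ 2 := by nlinarith
  rcases Nat.lt_or_ge k 2 with hk | hk
  · interval_cases k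
    · rcases h₁ with rfl | rfl <;> rcases h₂ with rfl | rfl
      · omega
      · omega
      · omega
      · have : q = 4 ∨ 5 ≤ q := by omega
        rcases this with rfl | h5
        · omega
        · have : 5 * q ≤ q ^ 2 := by nlinarith
          omega
    · rcases h₁ with rfl | rfl <;> rcases h₂ with rfl | rfl <;> omega
  · have : 2 * N ≤ k * N := Nat.mul_le_mul_right _ hk
    omega

/-! ### Fixed vectors and orbit sizes -/

section Orbits

variable {F V : Type*} [Field F] [Finite F] [AddCommGroup V] [Module F V]

theorem dvd_of_orderOf_prime_of_fixed {q r : ℕ} (hq : Nat.card F = q) (hV : Module.finrank F V = 3)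
    (hr : r.Prime) (g : V ≃ₗ[F] V) (hg : orderOf g = r) {v : V} (hv : v ≠ 0) (hgv : g v = v) :
    r ∣ q ∨ r ∣ q - 1 ∨ r ∣ q + 1 := by
  classical
  have : Module.Finite F V := Module.finite_of_finrank_pos (by omega)
  have : Finite V := Module.finite_of_finite F
  have : Fact r.Prime := ⟨hr⟩
  have hq1 : 1 ≤ q := hq ▸ Nat.card_pos
  let W : Submodule F V := LinearMap.eqLocus (g : V →ₗ[F] V) LinearMap.id
  have hfix : (MulAction.fixedPoints (Subgroup.zpowers g) V : Set V) = W := by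
    ext x
    simp only [MulAction.mem_fixedPoints, SetLike.mem_coe]
    constructor
    · intro h
      exact h ⟨g, Subgroup.mem_zpowers g⟩
    · intro h
      have hle : Subgroup.zpowers g ≤ MulAction.stabilizer (V ≃ₗ[F] V) x :=
        (Subgroup.zpowers_le).2 h
      exact fun m => hle m.2
  have hp : IsPGroup r (Subgroup.zpowers g) :=
    IsPGroup.of_card (n := 1) (by rw [Nat.card_zpowers, hg, pow_one])
  have hmod := hp.card_modEq_card_fixedPoints V
  have hcardW : Nat.card (MulAction.fixedPoints (Subgroup.zpowers g) V) =
      q ^ Module.finrank F W := by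
    rw [hfix, ← hq]
    exact Module.natCard_eq_pow_finrank (K := F) (V := W)
  rw [hcardW, Module.natCard_eq_pow_finrank (K := F) (V := V), hV, hq] at hmod
  have hpos : 0 < Module.finrank F W := by
    have : Nontrivial W := ⟨⟨v, hgv⟩, 0, fun h => hv (congrArg Subtype.val h)⟩
    exact Module.finrank_pos
  have hle : Module.finrank F W ≤ 3 := hV ▸ Submodule.finrank_le W
  have hne : Module.finrank F W ≠ 3 := by
    intro h3
    have hW : W = ⊤ := Submodule.eq_top_of_finrank_eq (h3.trans hV.symm)
    have : g = 1 := by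
      ext x
      have : x ∈ W := hW ▸ Submodule.mem_top
      exact this
    rw [this, orderOf_one] at hg
    exact hr.one_lt.ne hg
  have hd : r ∣ q ^ 3 - q ^ Module.finrank F W :=
    (Nat.modEq_iff_dvd' (Nat.pow_le_pow_right hq1 hle)).1 hmod.symm
  have key : r ∣ q ^ 2 * ((q - 1) * (q + 1)) := by
    refine hd.trans ?_
    obtain ⟨t, rfl⟩ := Nat.exists_eq_add_of_le hq1
    have : Module.finrank F W = 1 ∨ Module.finrank F W = 2 := by omega
    rcases this with h | h <;> rw [h]
    · have : (1 + t) ^ 3 - (1 + t) ^ 1 = (1 + t) * ((1 + t - 1) * (1 + t + 1)) := by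
        simp only [Nat.add_sub_cancel_left]
        apply Nat.sub_eq_of_eq_add; ring
      rw [this]
      exact Nat.mul_dvd_mul_right (dvd_pow_self _ two_ne_zero) _
    · have : (1 + t) ^ 3 - (1 + t) ^ 2 = (1 + t) ^ 2 * (1 + t - 1) := by
        simp only [Nat.add_sub_cancel_left]
        apply Nat.sub_eq_of_eq_add; ring
      rw [this]
      exact Nat.mul_dvd_mul_left _ (dvd_mul_right _ _)
  rcases (hr.dvd_mul).1 key with h | h
  · exact Or.inl (hr.dvd_of_dvd_pow h)
  · exact Or.inr ((hr.dvd_mul).1 h)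

theorem coprime_card_stabilizer {q n : ℕ} (hq : Nat.card F = q) (hV : Module.finrank F V = 3)
    (hn : Nat.gcd 3 (q - 1) * n = q ^ 2 + q + 1) (L : Subgroup (V ≃ₗ[F] V)) {v : V} (hv : v ≠ 0) :
    Nat.Coprime n (Nat.card (MulAction.stabilizer L v)) := by
  have : Module.Finite F V := Module.finite_of_finrank_pos (by omega)
  have : Finite V := Module.finite_of_finite F
  have : Finite (V ≃ₗ[F] V) := Finite.of_injective _ DFunLike.coe_injective
  refine Nat.coprime_of_dvd fun r hr hrn hrs => ?_
  have : Fact r.Prime := ⟨hr⟩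
  obtain ⟨g, hg⟩ := exists_prime_orderOf_dvd_card' r hrs
  obtain ⟨h1, h2, h3⟩ := prime_not_dvd_of_dvd_singer (hq ▸ Nat.card_pos) hn hr hrn
  have hg' : orderOf (g : L).1 = r := by rw [Subgroup.orderOf_coe, Subgroup.orderOf_coe, hg]
  rcases dvd_of_orderOf_prime_of_fixed hq hV hr _ hg' hv g.2 with h | h | h
  exacts [h1 h, h2 h, h3 h]

theorem dvd_card_orbit {q n : ℕ} (hq : Nat.card F = q) (hV : Module.finrank F V = 3)
    (hn : Nat.gcd 3 (q - 1) * n = q ^ 2 + q + 1) (L : Subgroup (V ≃ₗ[F] V))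
    {a : V ≃ₗ[F] V} (haL : a ∈ L)
    (ha : ∀ k, (∃ c : F, ∀ v, (a ^ k) v = c • v) → n ∣ k) {v : V} (hv : v ≠ 0) :
    n ∣ Nat.card (MulAction.orbit L v) := by
  have h1 : n ∣ Nat.card L := by
    refine (ha (orderOf a) ⟨1, fun v => by simp [pow_orderOf_eq_one]⟩).trans ?_
    rw [← Subgroup.orderOf_mk a haL]
    exact orderOf_dvd_natCard _
  have h2 : Nat.card (MulAction.orbit L v) * Nat.card (MulAction.stabilizer L v) = Nat.card L := by
    rw [← Nat.card_prod]
    exact Nat.card_congr (MulAction.orbitProdStabilizerEquivGroup L v)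
  rw [← h2] at h1
  exact (coprime_card_stabilizer hq hV hn L hv).dvd_of_dvd_mul_right h1

end Orbits

/-! ### The torus acting on `F × K` -/

section Torus

variable {F K : Type*} [Field F] [Field K] [Algebra F K] [Finite F] [Finite K]

theorem exists_smul_pow_mul_eq {q : ℕ} (hq : Nat.card F = q) (hK : Nat.card K = q ^ 2) {β : K}
    (hβ : Nat.gcd 3 (q - 1) * orderOf β = q ^ 2 - 1) (hβ0 : β ≠ 0) {y y' : K}
    (hy : y ≠ 0) (hy' : y' ≠ 0) : ∃ (j : ℕ) (c : F), c ≠ 0 ∧ y' = c • (β ^ j * y) := by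
  have hq1 : 1 < q := hq ▸ Finite.one_lt_card
  have hcF : Nat.card Fˣ = q - 1 := by rw [Nat.card_units, hq]
  have hcK : Nat.card Kˣ = (q - 1) * (q + 1) := by rw [Nat.card_units, hK, sq_sub_one_eq]
  set b : Kˣ := Units.mk0 β hβ0 with hb
  set φ : Fˣ →* Kˣ := Units.map (algebraMap F K).toMonoidHom with hφ
  have hφi : Function.Injective φ := Units.map_injective (algebraMap F K).injective
  have hbo : orderOf b = orderOf β := by rw [← orderOf_units, hb, Units.val_mk0]
  have hNpos : 0 < orderOf β := by rw [← hbo]; exact orderOf_pos b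
  have i1 : (Subgroup.zpowers b).index = Nat.gcd 3 (q - 1) := by
    have h := (Subgroup.zpowers b).card_mul_index
    rw [Nat.card_zpowers, hbo, hcK, ← sq_sub_one_eq, ← hβ, mul_comm] at h
    exact Nat.eq_of_mul_eq_mul_right hNpos h
  have i2 : φ.range.index = q + 1 := by
    have h := φ.range.card_mul_index
    rw [Nat.card_congr (MonoidHom.ofInjective hφi).symm.toEquiv, hcF, hcK] at h
    exact Nat.eq_of_mul_eq_mul_left (by omega) h
  have htop : Subgroup.zpowers b ⊔ φ.range = ⊤ := by
    rw [← Subgroup.index_eq_one]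
    apply Nat.eq_one_of_dvd_coprimes (coprime_gcd_three_pred_succ q hq1.le)
    · rw [← i1]; exact Subgroup.index_dvd_of_le le_sup_left
    · rw [← i2]; exact Subgroup.index_dvd_of_le le_sup_right
  have hmem : Units.mk0 y' hy' * (Units.mk0 y hy)⁻¹ ∈ Subgroup.zpowers b ⊔ φ.range :=
    htop ▸ Subgroup.mem_top _
  obtain ⟨z, hz, w, ⟨c, rfl⟩, hzw⟩ := Subgroup.mem_sup.1 hmem
  obtain ⟨j, rfl⟩ := (mem_powers_iff_mem_zpowers.2 hz)
  refine ⟨j, c, c.ne_zero, ?_⟩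
  have := congrArg Units.val (eq_mul_inv_iff_mul_eq.1 hzw)
  simp only [hb, hφ, Units.val_mul, Units.val_pow_eq_pow_val, Units.val_mk0, Units.coe_map] at this
  rw [← this, Algebra.smul_def]
  simp only [RingHom.toMonoidHom_eq_coe, MonoidHom.coe_coe]
  ring

/-- The size of a set of nonzero vectors of `F × K` stable under scalars and under
`(x, y) ↦ (x, β * y)`. -/
theorem exists_card_invariant_set {q : ℕ} (hq : Nat.card F = q) (hK : Nat.card K = q ^ 2) {β : K}
    (hβ : Nat.gcd 3 (q - 1) * orderOf β = q ^ 2 - 1) (hβ0 : β ≠ 0) (X : Set (F × K))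
    (h0 : (0 : F × K) ∉ X) (hs : ∀ c : F, c ≠ 0 → ∀ v ∈ X, c • v ∈ X)
    (hb : ∀ v ∈ X, (v.1, β * v.2) ∈ X) :
    ∃ k ε₁ ε₂, (ε₁ = 0 ∨ ε₁ = 1) ∧ (ε₂ = 0 ∨ (ε₂ = q + 1 ∧ ∀ y : K, y ≠ 0 → ((0 : F), y) ∈ X)) ∧
      X.ncard = (q - 1) * (ε₁ + ε₂ + k * orderOf β) := by
  classical
  have hcF : Nat.card Fˣ = q - 1 := by rw [Nat.card_units, hq]
  have hcK : Nat.card Kˣ = (q - 1) * (q + 1) := by rw [Nat.card_units, hK, sq_sub_one_eq]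
  have hbp : ∀ j : ℕ, ∀ v ∈ X, (v.1, β ^ j * v.2) ∈ X := by
    intro j
    induction j with
    | zero => intro v hv; simpa using hv
    | succ j ih =>
      intro v hv
      have := hb _ (ih v hv)
      rwa [← mul_assoc, ← pow_succ'] at this
  set T : Set Kˣ := {y | ((1 : F), (y : K)) ∈ X} with hT
  set b : Kˣ := Units.mk0 β hβ0 with hbdef
  have hbo : orderOf b = orderOf β := by rw [← orderOf_units, hbdef, Units.val_mk0]
  obtain ⟨k, hk⟩ : ∃ k, Nat.card T = k * orderOf β := by
    have hpre : T = (QuotientGroup.mk : Kˣ → Kˣ ⧸ Subgroup.zpowers b) ⁻¹' (QuotientGroup.mk '' T) := by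
      refine Set.Subset.antisymm (Set.subset_preimage_image _ _) ?_
      rintro y ⟨z, hz, hzy⟩
      obtain ⟨j, hj⟩ := mem_powers_iff_mem_zpowers.2 (QuotientGroup.eq.1 hzy)
      have hy : y = z * b ^ j := by
        have : b ^ j = z⁻¹ * y := hj
        rw [this, mul_inv_cancel_left]
      have := hbp j _ hz
      rw [hT, Set.mem_ofPred_eq, hy]
      simpa [hbdef, mul_comm] using this
    refine ⟨Nat.card (QuotientGroup.mk '' T : Set (Kˣ ⧸ Subgroup.zpowers b)), ?_⟩
    rw [hpre, Nat.card_congr (QuotientGroup.preimageMkEquivSubgroupProdSet _ _), Nat.card_prod,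
      Nat.card_zpowers, hbo, ← hpre, mul_comm]
  obtain ⟨ε₁, h₁, c₁⟩ : ∃ ε₁, (ε₁ = 0 ∨ ε₁ = 1) ∧ (X ∩ {v | v.2 = 0}).ncard = (q - 1) * ε₁ := by
    by_cases he : ((1 : F), (0 : K)) ∈ X
    · refine ⟨1, Or.inr rfl, ?_⟩
      have : X ∩ {v | v.2 = 0} = Set.range (fun c : Fˣ => ((c : F), (0 : K))) := by
        ext ⟨x, y⟩
        constructor
        · rintro ⟨hx, hy⟩
          have hy' : y = 0 := hy
          subst hy'
          have hx0 : x ≠ 0 := fun h => h0 (by rw [h] at hx; exact hx)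
          exact ⟨Units.mk0 x hx0, rfl⟩
        · rintro ⟨c, hc⟩
          rw [← hc]
          exact ⟨by simpa using hs c c.ne_zero _ he, rfl⟩
      rw [this, ← Nat.card_coe_set_eq, Nat.card_range_of_injective, hcF, mul_one]
      intro c d hcd
      exact Units.ext (congrArg Prod.fst hcd)
    · refine ⟨0, Or.inl rfl, ?_⟩
      have : X ∩ {v | v.2 = 0} = ∅ := by
        ext ⟨x, y⟩
        simp only [Set.mem_inter_iff, Set.mem_ofPred_eq, Set.mem_empty_iff_false, iff_false, not_and]
        rintro hx rfl
        have hx0 : x ≠ 0 := fun h => h0 (by rw [h] at hx; exact hx)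
        exact he (by simpa [hx0] using hs x⁻¹ (inv_ne_zero hx0) _ hx)
      rw [this, Set.ncard_empty, mul_zero]
  obtain ⟨ε₂, h₂, c₂⟩ : ∃ ε₂, (ε₂ = 0 ∨ (ε₂ = q + 1 ∧ ∀ y : K, y ≠ 0 → ((0 : F), y) ∈ X)) ∧
      ((X \ {v | v.2 = 0}) ∩ {v | v.1 = 0}).ncard = (q - 1) * ε₂ := by
    by_cases he : ∃ y : K, y ≠ 0 ∧ ((0 : F), y) ∈ X
    · obtain ⟨y, hy0, hy⟩ := he
      have hall : ∀ y' : K, y' ≠ 0 → ((0 : F), y') ∈ X := by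
        intro y' hy'
        obtain ⟨j, c, hc, rfl⟩ := exists_smul_pow_mul_eq hq hK hβ hβ0 hy0 hy'
        simpa using hs c hc _ (hbp j _ hy)
      refine ⟨q + 1, Or.inr ⟨rfl, hall⟩, ?_⟩
      have : (X \ {v | v.2 = 0}) ∩ {v | v.1 = 0} = Set.range (fun c : Kˣ => ((0 : F), (c : K))) := by
        ext ⟨x, y⟩
        constructor
        · rintro ⟨⟨hx, hy⟩, hx0⟩
          have hx' : x = 0 := hx0
          subst hx'
          exact ⟨Units.mk0 y hy, rfl⟩
        · rintro ⟨c, hc⟩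
          rw [← hc]
          exact ⟨⟨hall c c.ne_zero, c.ne_zero⟩, rfl⟩
      rw [this, ← Nat.card_coe_set_eq, Nat.card_range_of_injective, hcK]
      intro c d hcd
      exact Units.ext (congrArg Prod.snd hcd)
    · refine ⟨0, Or.inl rfl, ?_⟩
      have : (X \ {v | v.2 = 0}) ∩ {v | v.1 = 0} = ∅ := by
        ext ⟨x, y⟩
        simp only [Set.mem_inter_iff, Set.mem_sdiff, Set.mem_ofPred_eq, Set.mem_empty_iff_false,
          iff_false, not_and, and_imp]
        rintro hx hy rfl
        exact he ⟨y, hy, hx⟩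
      rw [this, Set.ncard_empty, mul_zero]
  have c₃ : ((X \ {v | v.2 = 0}) \ {v | v.1 = 0}).ncard = (q - 1) * (k * orderOf β) := by
    have : (X \ {v | v.2 = 0}) \ {v | v.1 = 0} =
        Set.range (fun p : Fˣ × T => ((p.1 : F), (p.1 : F) • ((p.2 : Kˣ) : K))) := by
      ext ⟨x, y⟩
      constructor
      · rintro ⟨⟨hx, hy⟩, hx0⟩
        have hx0' : x ≠ 0 := hx0
        have hy' : y ≠ 0 := hy
        refine ⟨(Units.mk0 x hx0, ⟨Units.mk0 (x⁻¹ • y) (smul_ne_zero (inv_ne_zero hx0) hy), ?_⟩), ?_⟩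
        · simpa [hT, hx0'] using hs x⁻¹ (inv_ne_zero hx0) _ hx
        · simp [hx0']
      · rintro ⟨⟨c, ⟨y, hy⟩⟩, hc⟩
        rw [← hc]
        refine ⟨⟨by simpa using hs c c.ne_zero _ hy, ?_⟩, c.ne_zero⟩
        exact smul_ne_zero c.ne_zero y.ne_zero
    rw [this, ← Nat.card_coe_set_eq, Nat.card_range_of_injective, Nat.card_prod, hcF, hk]
    rintro ⟨c, y⟩ ⟨d, z⟩ h
    have h1 : c = d := Units.ext (congrArg Prod.fst h)
    subst h1
    have h2 : (c : F) • ((y : Kˣ) : K) = (c : F) • ((z : Kˣ) : K) := congrArg Prod.snd h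
    have h3 := smul_right_injective K c.ne_zero h2
    exact Prod.ext rfl (Subtype.ext (Units.ext h3))
  refine ⟨k, ε₁, ε₂, h₁, h₂, ?_⟩
  have e1 := Set.ncard_inter_add_ncard_sdiff_eq_ncard X {v | v.2 = 0} (Set.toFinite _)
  have e2 := Set.ncard_inter_add_ncard_sdiff_eq_ncard (X \ {v | v.2 = 0}) {v | v.1 = 0}
    (Set.toFinite _)
  rw [← e1, ← e2, c₁, c₂, c₃]
  ring

end Torus

/-! ### Transitivity on nonzero vectors -/

section Transitivity

variable {F K : Type*} [Field F] [Field K] [Algebra F K] [Finite F] [Finite K]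

theorem finrank_prod_eq_three {q : ℕ} (hq : Nat.card F = q) (hK : Nat.card K = q ^ 2) :
    Module.finrank F K = 2 ∧ Module.finrank F (F × K) = 3 := by
  have hq1 : 1 < q := hq ▸ Finite.one_lt_card
  have h := Module.natCard_eq_pow_finrank (K := F) (V := K)
  rw [hK, hq] at h
  have h2 : Module.finrank F K = 2 := (Nat.pow_right_injective hq1 h).symm
  exact ⟨h2, by rw [Module.finrank_prod, h2, Module.finrank_self]⟩

theorem transitive_of_orders {q n : ℕ} (hq : Nat.card F = q) (hq2 : 2 < q)
    (hK : Nat.card K = q ^ 2) (hn : Nat.gcd 3 (q - 1) * n = q ^ 2 + q + 1) {β : K}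
    (hβ : Nat.gcd 3 (q - 1) * orderOf β = q ^ 2 - 1) (hβ0 : β ≠ 0)
    (L : Subgroup ((F × K) ≃ₗ[F] (F × K)))
    (hs : ∀ c : F, c ≠ 0 → ∃ g ∈ L, ∀ v, g v = c • v)
    {b : (F × K) ≃ₗ[F] (F × K)} (hbL : b ∈ L) (hb : ∀ v, b v = (v.1, β * v.2))
    {a : (F × K) ≃ₗ[F] (F × K)} (haL : a ∈ L)
    (ha : ∀ k, (∃ c : F, ∀ v, (a ^ k) v = c • v) → n ∣ k)
    {u v : F × K} (hu : u ≠ 0) (hv : v ≠ 0) : ∃ g ∈ L, g u = v := by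
  classical
  by_contra hcon
  push Not at hcon
  obtain ⟨-, hV⟩ := finrank_prod_eq_three hq hK
  set O : Set (F × K) := MulAction.orbit L u with hO
  have hmem : ∀ w, w ∈ O ↔ ∃ g ∈ L, g u = w := by
    intro w
    constructor
    · rintro ⟨g, rfl⟩; exact ⟨g, g.2, rfl⟩
    · rintro ⟨g, hg, rfl⟩; exact ⟨⟨g, hg⟩, rfl⟩
  have hOL : ∀ g ∈ L, ∀ w, g w ∈ O ↔ w ∈ O := by
    intro g hg w
    simp only [hmem]
    constructor
    · rintro ⟨x, hx, hxw⟩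
      refine ⟨g⁻¹ * x, L.mul_mem (L.inv_mem hg) hx, ?_⟩
      rw [LinearEquiv.mul_apply, hxw]
      exact g.symm_apply_apply w
    · rintro ⟨x, hx, hxw⟩
      exact ⟨g * x, L.mul_mem hg hx, by rw [LinearEquiv.mul_apply, hxw]⟩
  have hvO : v ∉ O := fun h => by
    obtain ⟨g, hg, hgv⟩ := (hmem v).1 h
    exact hcon g hg hgv
  have h0O : (0 : F × K) ∉ O := fun h => by
    obtain ⟨g, -, hg⟩ := (hmem 0).1 h
    exact hu (g.map_eq_zero_iff.1 hg)
  have hcard : ∀ X : Set (F × K), (0 : F × K) ∉ X → (∀ g ∈ L, ∀ w, w ∈ X → g w ∈ X) →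
      ∃ k ε₁ ε₂, (ε₁ = 0 ∨ ε₁ = 1) ∧ (ε₂ = 0 ∨ ε₂ = q + 1) ∧
      X.ncard = (q - 1) * (ε₁ + ε₂ + k * orderOf β) := by
    intro X hX0 hX
    obtain ⟨k, ε₁, ε₂, h1, h2, h3⟩ := exists_card_invariant_set hq hK hβ hβ0 X hX0
      (fun c hc w hw => by
        obtain ⟨g, hg, hgc⟩ := hs c hc
        rw [← hgc]; exact hX g hg w hw)
      (fun w hw => by rw [← hb]; exact hX b hbL w hw)
    exact ⟨k, ε₁, ε₂, h1, h2.imp id And.left, h3⟩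
  set Y : Set (F × K) := {w | w ≠ 0 ∧ w ∉ O} with hY
  have hYL : ∀ g ∈ L, ∀ w, w ∈ Y → g w ∈ Y := by
    rintro g hg w ⟨hw0, hw⟩
    exact ⟨fun h => hw0 (g.map_eq_zero_iff.1 h), fun h => hw ((hOL g hg w).1 h)⟩
  have htot : O.ncard + Y.ncard = (q - 1) * (q ^ 2 + q + 1) := by
    have hd : Disjoint O Y := Set.disjoint_left.2 fun w hw hw' => hw'.2 hw
    rw [← Set.ncard_union_eq hd]
    have : O ∪ Y = {0}ᶜ := by
      ext w
      by_cases hw : w = 0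
      · subst hw; simp [h0O, hY]
      · by_cases hw' : w ∈ O <;> simp [hw, hw', hY]
    rw [this, Set.ncard_compl, Set.ncard_singleton, Nat.card_prod, hq, hK, ← cube_sub_one_eq q (by omega)]
    congr 1
    ring
  have hnO : n ∣ O.ncard := by
    rw [← Nat.card_coe_set_eq]
    exact dvd_card_orbit hq hV hn L haL ha hu
  obtain ⟨k₀, δ₁, δ₂, -, -, hO1⟩ := hcard O h0O (fun g hg w hw => (hOL g hg w).2 hw)
  have hcop : Nat.Coprime n (q - 1) := Nat.coprime_of_dvd fun r hr hrn hrq =>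
    (prime_not_dvd_of_dvd_singer (by omega) hn hr hrn).2.1 hrq
  obtain ⟨j, hj⟩ : (q - 1) * n ∣ O.ncard :=
    Nat.Coprime.mul_dvd_of_dvd_of_dvd hcop.symm ⟨_, hO1⟩ hnO
  have hOpos : 0 < O.ncard := (Set.ncard_pos (Set.toFinite _)).2 ⟨u, MulAction.mem_orbit_self u⟩
  have hYpos : 0 < Y.ncard := (Set.ncard_pos (Set.toFinite _)).2 ⟨v, hv, hvO⟩
  have hmpos : 0 < (q - 1) * n := Nat.pos_of_ne_zero fun h => by rw [h, zero_mul] at hj; omega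
  have hjpos : 0 < j := Nat.pos_of_ne_zero fun h => by rw [h, mul_zero] at hj; omega
  set m := (q - 1) * n with hm
  have htot' : O.ncard + Y.ncard = Nat.gcd 3 (q - 1) * m := by
    rw [htot, ← hn, hm]; ring
  rcases gcd_three_eq_one_or_three (q - 1) with hd | hd
  · rw [hd] at htot'
    have : m * 1 ≤ m * j := Nat.mul_le_mul_left _ hjpos
    omega
  · rw [hd] at htot' hn hβ
    have hq4 : 4 ≤ q := by
      have h3 := Nat.gcd_dvd_right 3 (q - 1)
      rw [hd] at h3
      omega
    have hfinal : ∀ X : Set (F × K), (0 : F × K) ∉ X → (∀ g ∈ L, ∀ w, w ∈ X → g w ∈ X) →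
        X.ncard ≠ m := by
      intro X hX0 hX hXm
      obtain ⟨k, ε₁, ε₂, h1, h2, h3⟩ := hcard X hX0 hX
      rw [hXm, hm] at h3
      have h4 := Nat.eq_of_mul_eq_mul_left (by omega) h3
      exact no_invariant_set_card hq4 hβ h1 h2 (by rw [← h4, hn])
    have hj3 : j < 3 := by
      by_contra hge
      have : m * 3 ≤ m * j := Nat.mul_le_mul_left _ (by omega)
      omega
    interval_cases j
    · exact hfinal O h0O (fun g hg w hw => (hOL g hg w).2 hw) (by omega)
    · exact hfinal Y (fun h => h.1 rfl) hYL (by omega)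

end Transitivity

/-! ### Transvections -/

section Transvections

theorem Subring.eq_top_of_lt_card {K : Type*} [Field K] [Finite K] {q : ℕ}
    (hK : Nat.card K = q ^ 2) (S : Subring K) (hS : q < Nat.card S) : S = ⊤ := by
  by_contra hne
  obtain ⟨x, -, hx⟩ := SetLike.exists_of_lt (lt_top_iff_ne_top.2 hne)
  have hfield := Finite.isField_of_domain S
  have hinj : Function.Injective (fun p : S × S => (p.1 : K) + x * p.2) := by
    rintro ⟨a, b⟩ ⟨a', b'⟩ h
    have h' : (a : K) + x * b = a' + x * b' := h
    by_cases hbb : b = b'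
    · subst hbb
      exact Prod.ext (Subtype.ext (add_right_cancel h')) rfl
    · exfalso
      obtain ⟨c, hc⟩ := hfield.mul_inv_cancel (sub_ne_zero.2 hbb)
      have hc' : ((b : K) - b') * c = 1 := congrArg Subtype.val hc
      apply hx
      have : x = ((a' - a) * c : S) := by
        push_cast
        linear_combination (c : K) * h' - x * hc'
      rw [this]
      exact ((a' - a) * c).2
  have hle := Nat.card_le_card_of_injective _ hinj
  rw [Nat.card_prod, hK, sq] at hle
  exact absurd hle (not_le.2 (Nat.mul_self_lt_mul_self hS))

variable {F V : Type*} [Field F] [AddCommGroup V] [Module F V]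

/-- The group `L` contains the map `v ↦ v + φ v • u`. -/
def ContainsTransvection (L : Subgroup (V ≃ₗ[F] V)) (φ : V →ₗ[F] F) (u : V) : Prop :=
  ∃ g ∈ L, ∀ v, g v = v + φ v • u

namespace ContainsTransvection

variable {L : Subgroup (V ≃ₗ[F] V)} {φ ψ : V →ₗ[F] F} {u : V}

theorem zero : ContainsTransvection L 0 u := ⟨1, L.one_mem, by simp⟩

theorem add (hφ : ContainsTransvection L φ u) (hψ : ContainsTransvection L ψ u) (hu : φ u = 0) :
    ContainsTransvection L (φ + ψ) u := by
  obtain ⟨g, hg, hgv⟩ := hφ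
  obtain ⟨h, hh, hhv⟩ := hψ
  refine ⟨g * h, L.mul_mem hg hh, fun v => ?_⟩
  rw [LinearEquiv.mul_apply, hgv, hhv]
  simp only [map_add, map_smul, hu, smul_zero, add_zero, LinearMap.add_apply, add_smul]
  abel

theorem neg (hφ : ContainsTransvection L φ u) (hu : φ u = 0) :
    ContainsTransvection L (-φ) u := by
  obtain ⟨g, hg, hgv⟩ := hφ
  refine ⟨g⁻¹, L.inv_mem hg, fun v => ?_⟩
  change g.symm v = _
  rw [LinearEquiv.symm_apply_eq, hgv]
  simp [hu]

theorem conj (hφ : ContainsTransvection L φ u) {h : V ≃ₗ[F] V} (hh : h ∈ L) :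
    ContainsTransvection L (φ ∘ₗ (h.symm : V →ₗ[F] V)) (h u) := by
  obtain ⟨g, hg, hgv⟩ := hφ
  refine ⟨h * g * h⁻¹, L.mul_mem (L.mul_mem hh hg) (L.inv_mem hh), fun v => ?_⟩
  rw [LinearEquiv.mul_apply, LinearEquiv.mul_apply, hgv, map_add, map_smul]
  congr 1
  exact h.apply_symm_apply v

end ContainsTransvection

variable {K : Type*} [Field K] [Algebra F K] [Finite K]

/-- One nontrivial transvection with center `(1, 0)` yields all of them. -/
theorem containsTransvection_of_center {q : ℕ} (hq : Nat.card F = q) (hq2 : 2 < q)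
    (hK : Nat.card K = q ^ 2) {β : K}
    (hβ : Nat.gcd 3 (q - 1) * orderOf β = q ^ 2 - 1) (hβ0 : β ≠ 0)
    (L : Subgroup ((F × K) ≃ₗ[F] (F × K)))
    {b : (F × K) ≃ₗ[F] (F × K)} (hbL : b ∈ L) (hb : ∀ v, b v = (v.1, β * v.2))
    {φ₀ : (F × K) →ₗ[F] F} (hφ₀ : φ₀ ≠ 0) (h0 : φ₀ (1, 0) = 0)
    (hφ : ContainsTransvection L φ₀ (1, 0)) {φ : (F × K) →ₗ[F] F} (h1 : φ (1, 0) = 0) :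
    ContainsTransvection L φ (1, 0) := by
  have hsnd : ∀ ψ : (F × K) →ₗ[F] F, ψ (1, 0) = 0 →
      ψ = (ψ ∘ₗ LinearMap.inr F F K) ∘ₗ LinearMap.snd F F K := by
    intro ψ hψ
    apply LinearMap.ext
    rintro ⟨x, y⟩
    have : ((x, y) : F × K) = x • ((1 : F), (0 : K)) + (0, y) := by simp
    rw [this, map_add, map_smul, hψ]
    simp
  let E : (K →ₗ[F] F) → Prop := fun f => ContainsTransvection L (f ∘ₗ LinearMap.snd F F K) (1, 0)
  have Ezero : E 0 := by
    change ContainsTransvection L _ _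
    rw [LinearMap.zero_comp]
    exact ContainsTransvection.zero
  have Eadd : ∀ f g, E f → E g → E (f + g) := fun f g hf hg => by
    change ContainsTransvection L _ _
    rw [LinearMap.add_comp]
    exact ContainsTransvection.add hf hg (by simp)
  have Eneg : ∀ f, E f → E (-f) := fun f hf => by
    change ContainsTransvection L _ _
    rw [LinearMap.neg_comp]
    exact ContainsTransvection.neg hf (by simp)
  have Eβ : ∀ f, E f → E (f ∘ₗ LinearMap.mulLeft F β) := fun f hf => by
    have := ContainsTransvection.conj hf (L.inv_mem hbL)
    have e1 : b⁻¹ ((1 : F), (0 : K)) = (1, 0) := by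
      change b.symm _ = _
      rw [LinearEquiv.symm_apply_eq, hb]
      simp
    rw [e1] at this
    convert this using 1
    apply LinearMap.ext
    intro v
    change f (β * v.2) = f (b v).2
    rw [hb]
  let R : Subring K :=
    { carrier := {κ | ∀ f, E f → E (f ∘ₗ LinearMap.mulLeft F κ)}
      mul_mem' := fun {x y} hx hy f hf => by
        have := hy _ (hx f hf)
        rwa [LinearMap.comp_assoc, ← LinearMap.mulLeft_mul] at this
      one_mem' := fun f hf => by rwa [LinearMap.mulLeft_one, LinearMap.comp_id]
      add_mem' := fun {x y} hx hy f hf => by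
        have := Eadd _ _ (hx f hf) (hy f hf)
        convert this using 1
        ext z
        simp [add_mul]
      zero_mem' := fun f hf => by
        rw [LinearMap.mulLeft_zero_eq_zero, LinearMap.comp_zero]
        exact Ezero
      neg_mem' := fun {x} hx f hf => by
        have := Eneg _ (hx f hf)
        convert this using 1
        ext z
        simp }
  have hβR : β ∈ R := Eβ
  have hq4 : Nat.gcd 3 (q - 1) = 1 ∨ 4 ≤ q := by
    rcases gcd_three_eq_one_or_three (q - 1) with hd | hd
    · exact Or.inl hd
    · have h3 := Nat.gcd_dvd_right 3 (q - 1)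
      rw [hd] at h3
      right; omega
  have hRcard : q < Nat.card R := by
    have hle : orderOf β + 1 ≤ Nat.card R := by
      have : Function.Injective (fun o : Option (Fin (orderOf β)) =>
          (o.elim 0 fun j => ⟨β ^ (j : ℕ), R.pow_mem hβR _⟩ : R)) := by
        rintro (_ | i) (_ | j) h
        · rfl
        · exact absurd (congrArg Subtype.val h).symm (pow_ne_zero _ hβ0)
        · exact absurd (congrArg Subtype.val h) (pow_ne_zero _ hβ0)
        · exact congrArg some (Fin.ext (pow_injOn_Iio_orderOf i.2 j.2 (congrArg Subtype.val h)))
      simpa using Nat.card_le_card_of_injective _ this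
    have hsq : Nat.gcd 3 (q - 1) * orderOf β + 1 = q ^ 2 := by
      have : 1 ≤ q ^ 2 := Nat.one_le_pow _ _ (by omega)
      omega
    have hmul : 3 * q ≤ q ^ 2 := by nlinarith
    rcases hq4 with hd | h4
    · rw [hd] at hsq
      omega
    · have hmul : 4 * q ≤ q ^ 2 := by nlinarith
      rcases gcd_three_eq_one_or_three (q - 1) with hd | hd <;> rw [hd] at hsq <;> omega
  have hRtop := Subring.eq_top_of_lt_card hK R hRcard
  have hE0 : E (φ₀ ∘ₗ LinearMap.inr F F K) := by
    change ContainsTransvection L _ _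
    rwa [← hsnd φ₀ h0]
  have hf0 : φ₀ ∘ₗ LinearMap.inr F F K ≠ 0 := fun h => hφ₀ (by rw [hsnd φ₀ h0, h, LinearMap.zero_comp])
  have hsurj : ∃ κ, (φ₀ ∘ₗ LinearMap.inr F F K) ∘ₗ LinearMap.mulLeft F κ =
      φ ∘ₗ LinearMap.inr F F K := by
    let Φ : K →ₗ[F] (K →ₗ[F] F) :=
      { toFun := fun κ => (φ₀ ∘ₗ LinearMap.inr F F K) ∘ₗ LinearMap.mulLeft F κ
        map_add' := fun x y => by
          apply LinearMap.ext; intro z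
          change (φ₀ ∘ₗ LinearMap.inr F F K) ((x + y) * z) =
            (φ₀ ∘ₗ LinearMap.inr F F K) (x * z) + (φ₀ ∘ₗ LinearMap.inr F F K) (y * z)
          rw [add_mul, map_add]
        map_smul' := fun c x => by
          apply LinearMap.ext; intro z
          change (φ₀ ∘ₗ LinearMap.inr F F K) (c • x * z) = c • (φ₀ ∘ₗ LinearMap.inr F F K) (x * z)
          rw [smul_mul_assoc, map_smul] }
    have : Module.Finite F K := Module.Finite.of_finite
    have hinj : Function.Injective Φ := by
      rw [injective_iff_map_eq_zero]
      intro κ hκ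
      by_contra hκ0
      apply hf0
      apply LinearMap.ext
      intro z
      have := LinearMap.congr_fun hκ (κ⁻¹ * z)
      change (φ₀ ∘ₗ LinearMap.inr F F K) (κ * (κ⁻¹ * z)) = 0 at this
      rwa [mul_inv_cancel_left₀ hκ0] at this
    exact (LinearMap.injective_iff_surjective_of_finrank_eq_finrank
      (Subspace.dual_finrank_eq (K := F) (V := K)).symm).1 hinj _
  obtain ⟨κ, hκ⟩ := hsurj
  have hκR : κ ∈ R := hRtop ▸ Subring.mem_top κ
  have := hκR _ hE0
  rw [hκ] at this
  rw [hsnd φ h1]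
  exact this

/-- A subgroup which is transitive on nonzero vectors, contains the torus element and one
nontrivial transvection contains all transvections. -/
theorem containsTransvection_of_transitive {q : ℕ} (hq : Nat.card F = q) (hq2 : 2 < q)
    (hK : Nat.card K = q ^ 2) {β : K}
    (hβ : Nat.gcd 3 (q - 1) * orderOf β = q ^ 2 - 1) (hβ0 : β ≠ 0)
    (L : Subgroup ((F × K) ≃ₗ[F] (F × K)))
    (htrans : ∀ u v : F × K, u ≠ 0 → v ≠ 0 → ∃ g ∈ L, g u = v)
    {b : (F × K) ≃ₗ[F] (F × K)} (hbL : b ∈ L) (hb : ∀ v, b v = (v.1, β * v.2))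
    {φ₀ : (F × K) →ₗ[F] F} (hφ₀ : φ₀ ≠ 0) {u₀ : F × K} (hu₀ : u₀ ≠ 0) (h0 : φ₀ u₀ = 0)
    (hφ : ContainsTransvection L φ₀ u₀) (φ : (F × K) →ₗ[F] F) (u : F × K) (h1 : φ u = 0) :
    ContainsTransvection L φ u := by
  have he : ((1 : F), (0 : K)) ≠ 0 := fun h => one_ne_zero (congrArg Prod.fst h)
  obtain ⟨g, hg, hge⟩ := htrans u₀ (1, 0) hu₀ he
  have hstart := hφ.conj hg
  rw [hge] at hstart
  have hne : φ₀ ∘ₗ (g.symm : (F × K) →ₗ[F] (F × K)) ≠ 0 := fun h => hφ₀ <| by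
    apply LinearMap.ext
    intro v
    have := LinearMap.congr_fun h (g v)
    simpa using this
  by_cases hu : u = 0
  · subst hu
    exact ⟨1, L.one_mem, by simp⟩
  obtain ⟨h, hh, hhe⟩ := htrans (1, 0) u he hu
  have key := containsTransvection_of_center hq hq2 hK hβ hβ0 L hbL hb hne
    (by rw [← hge]; simpa using h0) hstart (φ := φ ∘ₗ (h : (F × K) →ₗ[F] (F × K)))
    (by simpa [hhe] using h1)
  have := key.conj hh
  rw [hhe] at this
  convert this using 1
  apply LinearMap.ext
  intro v
  simp

end Transvections

/-! ### Existence of a transvection when `q ≠ 4` -/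

section Friendship

open Finset in
/-- A symmetric irreflexive relation cannot have all its common neighbourhood sizes, and its number
of points, congruent to `-1` modulo a prime. -/
theorem false_of_common_neighbours {α : Type*} [Fintype α] {p : ℕ} [Fact p.Prime]
    (R : α → α → Prop) (hsymm : ∀ u w, R u w → R w u) (hirr : ∀ u, ¬ R u u)
    (hα : (Nat.card α : ZMod p) = -1)
    (hR : ∀ u w, (Set.ncard {x | R u x ∧ R w x} : ZMod p) = -1) : False := by
  classical
  let A : Matrix α α (ZMod p) := Matrix.of fun u w => if R u w then 1 else 0
  have hA2 : ∀ u w, (A ^ 2) u w = -1 := by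
    intro u w
    rw [← hR u w, sq, Matrix.mul_apply, Set.ncard_eq_toFinset_card', Finset.card_eq_sum_ones,
      Nat.cast_sum]
    simp only [A, Matrix.of_apply, mul_ite, mul_one, mul_zero, Nat.cast_one, Set.toFinset_ofPred,
      Finset.sum_filter]
    refine Finset.sum_congr rfl fun x _ => ?_
    have : R x w ↔ R w x := ⟨hsymm _ _, hsymm _ _⟩
    by_cases h1 : R u x <;> by_cases h2 : R w x <;> simp [h1, h2, this]
  have hrow : ∀ u, ∑ x, A u x = -1 := by
    intro u
    rw [← hR u u, Set.ncard_eq_toFinset_card', Finset.card_eq_sum_ones, Nat.cast_sum]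
    simp [A]
  have hpow : ∀ k, A ^ (k + 2) = (-1 : ZMod p) ^ k • A ^ 2 := by
    intro k
    induction k with
    | zero => simp
    | succ k ih =>
      have h1 : A * A ^ 2 = -A ^ 2 := by
        ext u w
        rw [Matrix.mul_apply, Matrix.neg_apply]
        simp only [hA2, mul_neg, mul_one, Finset.sum_neg_distrib, hrow]
      rw [show k + 1 + 2 = (k + 2) + 1 by ring, pow_succ', ih, Matrix.mul_smul, h1, pow_succ (-1 : ZMod p),
        mul_neg_one, neg_smul, smul_neg]
  have htr : Matrix.trace A = 0 := by
    simp [Matrix.trace, A, hirr]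
  have h2 : Matrix.trace (A ^ 2) = 1 := by
    simp only [Matrix.trace, Matrix.diag_apply, hA2, Finset.sum_neg_distrib, Finset.sum_const,
      Finset.card_univ, nsmul_eq_mul, mul_one, ← Nat.card_eq_fintype_card, hα, neg_neg]
  have hp := (Fact.out : p.Prime).two_le
  have h3 := ZMod.trace_pow_card A
  have h4 := hpow (p - 2)
  rw [Nat.sub_add_cancel hp] at h4
  rw [htr, zero_pow (by omega), h4, Matrix.trace_smul, h2] at h3
  simp at h3


theorem natCast_ncard_ker_inter_ker {F V : Type*} [Field F] [AddCommGroup V] [Module F V]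
    [Finite F] [Finite V] {p : ℕ} [CharP F p] [Fact p.Prime] (hV : Module.finrank F V = 3)
    (φ ψ : V →ₗ[F] F) :
    (Set.ncard {x : {v : V // v ≠ 0} | φ x = 0 ∧ ψ x = 0} : ZMod p) = -1 := by
  have : Module.Finite F V := Module.Finite.of_finite
  set W := LinearMap.ker (φ.prod ψ) with hW
  have hpos : 0 < Module.finrank F W := by
    have h1 := LinearMap.finrank_range_add_finrank_ker (φ.prod ψ)
    have h2 := Submodule.finrank_le (LinearMap.range (φ.prod ψ))
    rw [Module.finrank_prod, Module.finrank_self] at h2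
    rw [hV] at h1
    rw [hW]
    omega
  have hcard : Set.ncard {x : {v : V // v ≠ 0} | φ x = 0 ∧ ψ x = 0} + 1 = Nat.card W := by
    have h1 : (Subtype.val '' {x : {v : V // v ≠ 0} | φ x = 0 ∧ ψ x = 0}) = (W : Set V) \ {0} := by
      ext v
      constructor
      · rintro ⟨x, ⟨h1, h2⟩, rfl⟩
        exact ⟨by simp [hW, h1, h2], x.2⟩
      · rintro ⟨h1, h2⟩
        have h1' : φ v = 0 ∧ ψ v = 0 := by simpa [hW] using h1
        exact ⟨⟨v, h2⟩, h1', rfl⟩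
    rw [← Set.ncard_image_of_injective _ Subtype.val_injective, h1,
      Set.ncard_sdiff_singleton_add_one (show (0 : V) ∈ (W : Set V) from W.zero_mem)]
    rfl
  have hp0 : (Nat.card F : ZMod p) = 0 := by
    have : Fintype F := Fintype.ofFinite F
    rw [Nat.card_eq_fintype_card, ZMod.natCast_eq_zero_iff]
    exact (CharP.cast_eq_zero_iff F p _).1 (Nat.cast_card_eq_zero F)
  have h := congrArg (Nat.cast (R := ZMod p)) hcard
  rw [Module.natCard_eq_pow_finrank (K := F) (V := W), Nat.cast_pow, hp0, zero_pow hpos.ne'] at h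
  push_cast at h
  exact eq_neg_of_add_eq_zero_left h


variable {F K : Type*} [Field F] [Field K] [Algebra F K] [Finite F] [Finite K]

theorem exists_algebraMap_eq_of_pow_card {F K : Type*} [Field F] [Field K] [Algebra F K] [Finite F]
    {x : K} (hx : x ^ Nat.card F = x) : ∃ y : F, algebraMap F K y = x := by
  classical
  have : Fintype F := Fintype.ofFinite F
  rw [Nat.card_eq_fintype_card] at hx
  set P : Polynomial F := Polynomial.X ^ Fintype.card F - Polynomial.X with hP
  have hcard := FiniteField.X_pow_card_sub_X_natDegree_eq F (Fintype.one_lt_card (α := F))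
  have hroots := FiniteField.roots_X_pow_card_sub_X F
  have h := (Polynomial.roots_map_of_injective_of_card_eq_natDegree (p := P)
    (algebraMap F K).injective (by rw [hP, hroots, hcard]; rfl)).symm
  have hP0 : P.map (algebraMap F K) ≠ 0 :=
    Polynomial.map_ne_zero (FiniteField.X_pow_card_sub_X_ne_zero F Fintype.one_lt_card)
  have hxr : x ∈ (P.map (algebraMap F K)).roots := by
    rw [Polynomial.mem_roots hP0]
    simp [hP, hx]
  rw [h, Multiset.mem_map] at hxr
  obtain ⟨y, -, hy⟩ := hxr
  exact ⟨y, hy⟩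

theorem exists_mem_stabilizer_fst_ne {q : ℕ} (hq : Nat.card F = q) (hq2 : 2 < q) (hq4 : q ≠ 4)
    (hK : Nat.card K = q ^ 2) {β : K}
    (hβ : Nat.gcd 3 (q - 1) * orderOf β = q ^ 2 - 1) (hβ0 : β ≠ 0)
    (L : Subgroup ((F × K) ≃ₗ[F] (F × K)))
    (hs : ∀ c : F, c ≠ 0 → ∃ g ∈ L, ∀ v, g v = c • v)
    (htrans : ∀ u v : F × K, u ≠ 0 → v ≠ 0 → ∃ g ∈ L, g u = v)
    {b : (F × K) ≃ₗ[F] (F × K)} (hbL : b ∈ L) (hb : ∀ v, b v = (v.1, β * v.2)) :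
    ∃ g ∈ L, g (1, 0) = (1, 0) ∧ ∃ w, (g w).1 ≠ w.1 := by
  by_contra hcon
  push Not at hcon
  obtain ⟨-, hV⟩ := finrank_prod_eq_three hq hK
  have he : ((1 : F), (0 : K)) ≠ 0 := fun h => one_ne_zero (congrArg Prod.fst h)
  have hθ : ∀ u : {v : F × K // v ≠ 0}, ∃ θ : (F × K) →ₗ[F] F,
      ∀ g ∈ L, g (1, 0) = u.1 → ∀ w, θ (g w) = w.1 := by
    intro u
    obtain ⟨g, hg, hgu⟩ := htrans (1, 0) u.1 he u.2
    refine ⟨LinearMap.fst F F K ∘ₗ (g.symm : (F × K) →ₗ[F] (F × K)), fun h hh hhu w => ?_⟩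
    refine hcon (g⁻¹ * h) (L.mul_mem (L.inv_mem hg) hh) ?_ w
    rw [LinearEquiv.mul_apply, hhu, ← hgu]
    exact g.symm_apply_apply _
  choose θ hθ using hθ
  let act : ∀ g : (F × K) ≃ₗ[F] (F × K), {v : F × K // v ≠ 0} → {v : F × K // v ≠ 0} :=
    fun g u => ⟨g u.1, fun h => u.2 (g.map_eq_zero_iff.1 h)⟩
  have hact : ∀ g ∈ L, ∀ u w, θ (act g u) (g w) = θ u w := by
    intro g hg u w
    obtain ⟨h, hh, hhu⟩ := htrans (1, 0) u.1 he u.2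
    have h1 := hθ u h hh hhu (h.symm w)
    rw [h.apply_symm_apply] at h1
    have h2 := hθ (act g u) (g * h) (L.mul_mem hg hh) (congrArg g hhu) (h.symm w)
    rw [LinearEquiv.mul_apply, h.apply_symm_apply] at h2
    rw [h1, h2]
  set e : {v : F × K // v ≠ 0} := ⟨(1, 0), he⟩ with hedef
  have hθe : ∀ w, θ e w = w.1 := fun w => hθ e 1 L.one_mem rfl w
  have hself : ∀ u, θ u u = 1 := by
    intro u
    obtain ⟨h, hh, hhu⟩ := htrans (1, 0) u.1 he u.2
    rw [← hhu, hθ u h hh hhu]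
  have hfst : Set.ncard {w : {v : F × K // v ≠ 0} | w.1.1 = 0} = q ^ 2 - 1 := by
    have : Subtype.val '' {w : {v : F × K // v ≠ 0} | w.1.1 = 0} =
        (fun y : K => ((0 : F), y)) '' {0}ᶜ := by
      ext v
      constructor
      · rintro ⟨⟨⟨x, y⟩, hv⟩, h, rfl⟩
        obtain rfl : x = 0 := h
        exact ⟨y, fun h : y = 0 => hv (by rw [h]; rfl), rfl⟩
      · rintro ⟨y, hy, rfl⟩
        exact ⟨⟨(0, y), fun h => hy (congrArg Prod.snd h)⟩, rfl, rfl⟩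
    rw [← Set.ncard_image_of_injective _ Subtype.val_injective, this,
      Set.ncard_image_of_injective _ (fun x y h => congrArg Prod.snd h), Set.ncard_compl,
      Set.ncard_singleton, hK]
  have hinj : ∀ g, Function.Injective (act g) := fun g x y h =>
    Subtype.ext (g.injective (congrArg Subtype.val h))
  have hleft : ∀ u, Set.ncard {w : {v : F × K // v ≠ 0} | θ u w = 0} = q ^ 2 - 1 := by
    intro u
    obtain ⟨g, hg, hgu⟩ := htrans (1, 0) u.1 he u.2
    rw [← hfst, ← Set.ncard_image_of_injective {w : {v : F × K // v ≠ 0} | w.1.1 = 0} (hinj g)]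
    congr 1
    ext w
    constructor
    · intro hw
      refine ⟨act g⁻¹ w, ?_, Subtype.ext (g.apply_symm_apply _)⟩
      have := hθ u g hg hgu (g.symm w)
      rw [g.apply_symm_apply] at this
      exact this.symm.trans hw
    · rintro ⟨w, hw, rfl⟩
      exact (hθ u g hg hgu w).trans hw
  have hright : ∀ u : {v : F × K // v ≠ 0}, Set.ncard {w | θ w u.1 = 0} = Set.ncard {w | θ w e.1 = 0} := by
    intro u
    obtain ⟨g, hg, hgu⟩ := htrans (1, 0) u.1 he u.2
    rw [← Set.ncard_image_of_injective {w | θ w e.1 = 0} (hinj g)]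
    congr 1
    ext w
    constructor
    · intro hw
      refine ⟨act g⁻¹ w, ?_, Subtype.ext (g.apply_symm_apply _)⟩
      have h1 := hact g hg (act g⁻¹ w) e.1
      have h2 : act g (act g⁻¹ w) = w := Subtype.ext (g.apply_symm_apply _)
      rw [h2] at h1
      refine h1.symm.trans ?_
      rw [hedef, hgu]
      exact hw
    · rintro ⟨w, hw, rfl⟩
      have h1 := hact g hg w e.1
      rw [hedef, hgu] at h1
      exact h1.trans hw
  have hScard : Set.ncard {w | θ w e.1 = 0} = q ^ 2 - 1 := by
    classical
    have : Fintype {v : F × K // v ≠ 0} := Fintype.ofFinite _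
    have := Finset.card_mul_eq_card_mul (s := Finset.univ) (t := Finset.univ)
      (fun u w : {v : F × K // v ≠ 0} => θ u w = 0) (m := q ^ 2 - 1)
      (n := Set.ncard {w | θ w e.1 = 0})
      (fun u _ => by
        rw [← hleft u, Set.ncard_eq_toFinset_card']
        congr 1
        ext; simp [Finset.bipartiteAbove])
      (fun u _ => by
        rw [← hright u, Set.ncard_eq_toFinset_card']
        congr 1
        ext; simp [Finset.bipartiteBelow])
    exact (Nat.eq_of_mul_eq_mul_left (Finset.card_pos.2 ⟨e, Finset.mem_univ _⟩) this).symm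
  set X : Set (F × K) := Subtype.val '' {w | θ w e.1 = 0} with hX
  have hXcard : X.ncard = q ^ 2 - 1 := by
    rw [hX, Set.ncard_image_of_injective _ Subtype.val_injective, hScard]
  obtain ⟨k, ε₁, ε₂, h1, h2, h3⟩ := exists_card_invariant_set hq hK hβ hβ0 X
    (by rintro ⟨w, -, hw⟩; exact w.2 hw)
    (by
      rintro c hc _ ⟨w, hw, rfl⟩
      obtain ⟨g, hg, hgc⟩ := hs c hc
      refine ⟨act g w, ?_, hgc _⟩
      have := hact g hg w (c⁻¹ • e.1)
      rw [hgc, smul_inv_smul₀ hc, map_smul, show θ w e.1 = 0 from hw, smul_zero] at this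
      exact this)
    (by
      rintro _ ⟨w, hw, rfl⟩
      refine ⟨act b w, ?_, hb _⟩
      have := hact b hbL w e.1
      rw [hb] at this
      simp only [hedef, mul_zero] at this
      exact this.trans hw)
  have hsq : 1 ≤ q ^ 2 := Nat.one_le_pow _ _ (by omega)
  have hell : ∀ y : K, y ≠ 0 → ((0 : F), y) ∈ X := by
    rcases h2 with rfl | h2
    · exfalso
      rw [hXcard, sq_sub_one_eq, add_zero] at h3
      have h4 := Nat.eq_of_mul_eq_mul_left (by omega) h3
      rcases h1 with rfl | rfl
      · rw [sq_sub_one_eq, h4, zero_add, ← mul_assoc] at hβ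
        have hN : 0 < orderOf β := Nat.pos_of_ne_zero fun h => by rw [h] at h4; omega
        have h5 := Nat.eq_of_mul_eq_mul_right hN hβ
        rcases gcd_three_eq_one_or_three (q - 1) with hd | hd
        · rw [hd] at h5
          have := Nat.eq_one_of_mul_eq_one_right h5.symm
          omega
        · rw [hd] at h5
          rcases (Nat.dvd_prime Nat.prime_three).1 (Dvd.intro _ h5.symm) with h | h <;> omega
      · have h5 : q = k * orderOf β := by omega
        have h6 : orderOf β ∣ q ^ 2 - 1 := ⟨_, by rw [← hβ, mul_comm]⟩
        have h7 : orderOf β ∣ q ^ 2 := (Dvd.intro_left _ h5.symm).trans (Dvd.intro_left q (sq q).symm)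
        have h8 : orderOf β = 1 := by
          rw [← Nat.dvd_one]
          have := Nat.dvd_sub h7 h6
          rwa [Nat.sub_sub_self hsq] at this
        rw [h8] at hβ
        have : 3 * 3 ≤ q ^ 2 := by nlinarith
        rcases gcd_three_eq_one_or_three (q - 1) with hd | hd <;> omega
    · exact h2.2
  have hXeq : X = Subtype.val '' {w : {v : F × K // v ≠ 0} | w.1.1 = 0} := by
    symm
    refine Set.eq_of_subset_of_ncard_le ?_ ?_ (Set.toFinite _)
    · rintro _ ⟨⟨⟨x, y⟩, hv⟩, h, rfl⟩
      obtain rfl : x = 0 := h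
      exact hell y fun h => hv (by rw [h]; rfl)
    · rw [hXcard, Set.ncard_image_of_injective _ Subtype.val_injective, hfst]
  have hiff : ∀ w, θ w e.1 = 0 ↔ θ e w.1 = 0 := by
    intro w
    rw [hθe]
    have h1 : w.1 ∈ X ↔ θ w e.1 = 0 := by simp [hX, w.2]
    have h2 : w.1 ∈ X ↔ w.1.1 = 0 := by rw [hXeq]; simp [w.2]
    rw [← h1, h2]
  have hsymm : ∀ u w, θ u w.1 = 0 → θ w u.1 = 0 := by
    intro u w h
    obtain ⟨g, hg, hgu⟩ := htrans (1, 0) u.1 he u.2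
    have hu : act g e = u := Subtype.ext hgu
    have hw : act g (act g⁻¹ w) = w := Subtype.ext (g.apply_symm_apply _)
    have h1 := hact g hg e (act g⁻¹ w).1
    have h2 := hact g hg (act g⁻¹ w) e.1
    have hw' : g (act g⁻¹ w).1 = w.1 := congrArg Subtype.val hw
    have hu' : g e.1 = u.1 := hgu
    rw [hu, hw'] at h1
    rw [hw, hu'] at h2
    rw [h2, hiff, ← h1, h]
  obtain ⟨p, hp⟩ := CharP.exists F
  have hpp : Fact p.Prime := ⟨CharP.char_is_prime F p⟩
  have : Fintype {v : F × K // v ≠ 0} := Fintype.ofFinite _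
  have hcount := natCast_ncard_ker_inter_ker (p := p) hV
  refine false_of_common_neighbours (p := p) (fun u w => θ u w.1 = 0) hsymm
    (fun u h => one_ne_zero ((hself u).symm.trans h)) ?_ (fun u w => hcount (θ u) (θ w))
  have := hcount 0 0
  simpa [Set.ncard_univ] using this

theorem exists_containsTransvection_of_ne_four {q : ℕ} (hq : Nat.card F = q) (hq2 : 2 < q)
    (hq4 : q ≠ 4) (hK : Nat.card K = q ^ 2) {β : K}
    (hβ : Nat.gcd 3 (q - 1) * orderOf β = q ^ 2 - 1) (hβ0 : β ≠ 0)
    (L : Subgroup ((F × K) ≃ₗ[F] (F × K)))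
    (hs : ∀ c : F, c ≠ 0 → ∃ g ∈ L, ∀ v, g v = c • v)
    (htrans : ∀ u v : F × K, u ≠ 0 → v ≠ 0 → ∃ g ∈ L, g u = v)
    {b : (F × K) ≃ₗ[F] (F × K)} (hbL : b ∈ L) (hb : ∀ v, b v = (v.1, β * v.2)) :
    ∃ (φ : (F × K) →ₗ[F] F) (u : F × K), φ ≠ 0 ∧ u ≠ 0 ∧ φ u = 0 ∧
      ContainsTransvection L φ u := by
  have he : ((1 : F), (0 : K)) ≠ 0 := fun h => one_ne_zero (congrArg Prod.fst h)
  obtain ⟨g, hg, hge, w, hw⟩ := exists_mem_stabilizer_fst_ne hq hq2 hq4 hK hβ hβ0 L hs htrans hbL hb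
  have hsq : 1 ≤ q ^ 2 := Nat.one_le_pow _ _ (by omega)
  obtain ⟨γ, hγ⟩ : ∃ γ : F, algebraMap F K γ = β ^ (q + 1) := by
    apply exists_algebraMap_eq_of_pow_card
    have h1 : (β ^ (q + 1)) ^ (q - 1) = 1 := by
      rw [← pow_mul, mul_comm, ← sq_sub_one_eq, ← hβ, mul_comm, pow_mul, pow_orderOf_eq_one,
        one_pow]
    rw [hq, ← Nat.sub_add_cancel (show 1 ≤ q by omega), pow_succ _ (q - 1)]
    rw [Nat.sub_add_cancel (show 1 ≤ q by omega), h1, one_mul]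
  have hγ1 : γ ≠ 1 := by
    intro h
    rw [h, map_one] at hγ
    obtain ⟨k, hk⟩ := orderOf_dvd_of_pow_eq_one hγ.symm
    have hN : 0 < orderOf β := Nat.pos_of_ne_zero fun h => by rw [h] at hk; omega
    rw [sq_sub_one_eq, hk, mul_comm (orderOf β), ← mul_assoc] at hβ
    have h5 := Nat.eq_of_mul_eq_mul_right hN hβ
    rcases gcd_three_eq_one_or_three (q - 1) with hd | hd
    · rw [hd] at h5
      have := Nat.eq_one_of_mul_eq_one_right h5.symm
      omega
    · rw [hd] at h5
      rcases (Nat.dvd_prime Nat.prime_three).1 (Dvd.intro _ h5.symm) with h | h <;> omega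
  have hpow : ∀ j : ℕ, ∀ v, (b ^ j) v = (v.1, β ^ j * v.2) := by
    intro j
    induction j with
    | zero => intro v; simp
    | succ j ih => intro v; rw [pow_succ, LinearEquiv.mul_apply, ih, hb, pow_succ, mul_assoc]
  set h := b ^ (q + 1) with hh
  have hhL : h ∈ L := L.pow_mem hbL _
  have hhv : ∀ v, h v = γ • v + ((1 - γ) * v.1) • ((1 : F), (0 : K)) := by
    intro v
    rw [hpow, ← hγ, ← Algebra.smul_def]
    ext
    · simp; ring
    · simp
  have hge' : g⁻¹ (1, 0) = (1, 0) := by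
    change g.symm _ = _
    rw [LinearEquiv.symm_apply_eq, hge]
  set φ : (F × K) →ₗ[F] F := (1 - γ) • (LinearMap.fst F F K ∘ₗ
    (g⁻¹ : (F × K) ≃ₗ[F] (F × K)).toLinearMap - LinearMap.fst F F K) with hφ
  have hφv : ∀ v, φ v = (1 - γ) * ((g⁻¹ v).1 - v.1) := fun v => rfl
  refine ⟨φ, (1, 0), ?_, he, by rw [hφv, hge']; simp, h⁻¹ * g * h * g⁻¹,
    L.mul_mem (L.mul_mem (L.mul_mem (L.inv_mem hhL) hg) hhL) (L.inv_mem hg), fun v => ?_⟩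
  · intro h0
    have h1 := hφv (g w)
    have h2 : g⁻¹ (g w) = w := g.symm_apply_apply w
    rw [h0, h2, LinearMap.zero_apply, eq_comm, mul_eq_zero, sub_eq_zero, sub_eq_zero] at h1
    exact h1.elim (fun h => hγ1 h.symm) fun h => hw h.symm
  · rw [LinearEquiv.mul_apply, LinearEquiv.mul_apply, LinearEquiv.mul_apply]
    change h.symm _ = _
    have hgg : g (g⁻¹ v) = v := g.apply_symm_apply v
    rw [LinearEquiv.symm_apply_eq, hhv (g⁻¹ v), map_add, map_smul, map_smul, hge, hgg, hhv, hφv]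
    ext
    · simp; ring
    · simp

end Friendship

/-! ### Fields with four elements -/

section CardFour

theorem Subgroup.mem_centralizer_of_coprime {G : Type*} [Group G] [Finite G] (H : Subgroup G)
    [IsCyclic H] {g : G} (hg : g ∈ Subgroup.normalizer (H : Set G))
    (hc : Nat.Coprime (orderOf g) (Nat.totient (Nat.card H))) :
    g ∈ Subgroup.centralizer (H : Set G) := by
  have h1 : orderOf (H.normalizerMonoidHom ⟨g, hg⟩) ∣ orderOf g := by
    rw [← Subgroup.orderOf_mk g hg]
    exact orderOf_map_dvd H.normalizerMonoidHom ⟨g, hg⟩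
  have h2 : orderOf (H.normalizerMonoidHom ⟨g, hg⟩) ∣ Nat.totient (Nat.card H) := by
    have := _root_.orderOf_dvd_natCard (H.normalizerMonoidHom ⟨g, hg⟩)
    rwa [IsCyclic.card_mulAut] at this
  have h3 := Nat.eq_one_of_dvd_coprimes hc h1 h2
  have h4 : (⟨g, hg⟩ : Subgroup.normalizer (H : Set G)) ∈ H.normalizerMonoidHom.ker :=
    MonoidHom.mem_ker.2 (orderOf_eq_one_iff.1 h3)
  rwa [Subgroup.normalizerMonoidHom_ker] at h4

theorem commute_of_orderOf_eq_seven_five {G : Type*} [Group G] [Finite G]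
    (hG : Nat.card G ∣ 3 ^ 4 * 5 * 7) {x y : G} (hx : orderOf x = 7) (hy : orderOf y = 5) :
    Commute x y := by
  have hp5 : Fact (Nat.Prime 5) := ⟨by norm_num⟩
  have hp7 : Fact (Nat.Prime 7) := ⟨by norm_num⟩
  have hcardy : Nat.card (Subgroup.zpowers y) = 5 := by rw [Nat.card_zpowers, hy]
  have hsylow : ∀ {p : ℕ} [Fact p.Prime] {H : Type _} [Group H] [Finite H] (z : H),
      orderOf z = p → ¬ p ^ 2 ∣ Nat.card H → ∃ P : Sylow p H, (P : Subgroup H) = Subgroup.zpowers z := by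
    intro p _ H _ _ z hz hH
    refine ⟨Sylow.ofCard (Subgroup.zpowers z) ?_, rfl⟩
    have h1 : p ∣ Nat.card H := hz ▸ orderOf_dvd_natCard z
    have h2 : (Nat.card H).factorization p = 1 := by
      apply le_antisymm
      · by_contra h
        exact hH ((Nat.Prime.pow_dvd_iff_le_factorization Fact.out Nat.card_pos.ne').2 (by omega))
      · exact (Nat.Prime.pow_dvd_iff_le_factorization Fact.out Nat.card_pos.ne').1 (by simpa using h1)
    rw [Nat.card_zpowers, hz, h2, pow_one]
  obtain ⟨P, hP⟩ := hsylow (p := 5) y hy fun h => by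
    have := h.trans hG
    norm_num at this
  have hodd : ∀ g : G, orderOf g ∣ 3 ^ 4 * 5 * 7 := fun g => (orderOf_dvd_natCard g).trans hG
  have hcyc : IsCyclic (P : Subgroup G) := by rw [hP]; infer_instance
  have hN : Subgroup.normalizer (P : Set G) ≤ Subgroup.centralizer (P : Set G) := by
    intro g hg
    refine Subgroup.mem_centralizer_of_coprime (P : Subgroup G) hg ?_
    rw [hP, hcardy, Nat.totient_prime (by norm_num)]
    exact Nat.Coprime.coprime_dvd_left (hodd g) (by norm_num)
  set f := MonoidHom.transferSylow P hN with hf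
  set N := f.ker with hNdef
  have hxN : x ∈ N := by
    rw [hNdef, MonoidHom.mem_ker, ← orderOf_eq_one_iff]
    refine Nat.eq_one_of_dvd_coprimes (a := 7) (b := 5) (by norm_num) (hx ▸ orderOf_map_dvd f x) ?_
    have := orderOf_dvd_natCard (f x)
    have hc : Nat.card P = 5 := by
      rw [hP, hcardy]
    rwa [hc] at this
  have hNcard : Nat.card N ∣ 3 ^ 4 * 7 := by
    have h1 := MonoidHom.not_dvd_card_ker_transferSylow P hN
    have h2 : Nat.card N ∣ 5 * (3 ^ 4 * 7) := (Subgroup.card_subgroup_dvd_card N).trans hG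
    exact ((Nat.Prime.coprime_iff_not_dvd (by norm_num)).2 h1).symm.dvd_of_dvd_mul_left h2
  obtain ⟨Q, hQ⟩ := hsylow (p := 7) (⟨x, hxN⟩ : N) (by rw [Subgroup.orderOf_mk, hx]) fun h => by
    have := h.trans hNcard
    norm_num at this
  have hQcard : Nat.card (Q : Subgroup N) = 7 := by
    rw [hQ, Nat.card_zpowers, Subgroup.orderOf_mk, hx]
  have hQone : Nat.card (Sylow 7 N) = 1 := by
    have h1 := card_sylow_modEq_one 7 N
    have h2 : Nat.card (Sylow 7 N) ∣ 3 ^ 4 := by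
      refine Q.card_dvd_index.trans ?_
      have := (Q : Subgroup N).card_mul_index
      rw [hQcard] at this
      rw [← this, mul_comm] at hNcard
      exact Nat.dvd_of_mul_dvd_mul_right (by norm_num) hNcard
    obtain ⟨k, hk, hk'⟩ := (Nat.dvd_prime_pow Nat.prime_three).1 h2
    rw [hk'] at h1 ⊢
    interval_cases k <;> first | rfl | exact absurd h1 (by decide)
  have hsub : Subsingleton (Sylow 7 N) := (Nat.card_eq_one_iff_unique.1 hQone).1
  have hconj : y * x * y⁻¹ ∈ Subgroup.zpowers x := by
    have hmem : y * x * y⁻¹ ∈ N := (MonoidHom.normal_ker f).conj_mem x hxN y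
    have hord : orderOf (y * x * y⁻¹) = 7 := by
      rw [← hx]; exact (orderOf_injective (MulAut.conj y).toMonoidHom (MulAut.conj y).injective x)
    obtain ⟨Q', hQ'⟩ := hsylow (p := 7) (⟨_, hmem⟩ : N) (by rw [Subgroup.orderOf_mk, hord]) fun h => by
      have := h.trans hNcard
      norm_num at this
    rw [Subsingleton.elim Q' Q, hQ] at hQ'
    have h3 : (⟨_, hmem⟩ : N) ∈ Subgroup.zpowers (⟨x, hxN⟩ : N) := by
      rw [hQ']; exact Subgroup.mem_zpowers _
    obtain ⟨k, hk⟩ := Subgroup.mem_zpowers_iff.1 h3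
    exact Subgroup.mem_zpowers_iff.2 ⟨k, congrArg Subtype.val hk⟩
  have hnorm : y ∈ Subgroup.normalizer (Subgroup.zpowers x : Set G) := by
    rw [Subgroup.mem_normalizer_iff_map_conj_eq, MonoidHom.map_zpowers]
    refine Subgroup.eq_of_le_of_card_ge (Subgroup.zpowers_le.2 hconj) (le_of_eq ?_)
    rw [Nat.card_zpowers, Nat.card_zpowers]
    exact (orderOf_injective (MulAut.conj y).toMonoidHom (MulAut.conj y).injective x).symm
  have := Subgroup.mem_centralizer_of_coprime (Subgroup.zpowers x) hnorm (by
    rw [Nat.card_zpowers, hx, hy, Nat.totient_prime (by norm_num)]; norm_num)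
  exact (Subgroup.mem_centralizer_iff.1 this) x (Subgroup.mem_zpowers x)

variable {F V : Type*} [Field F] [Finite F] [AddCommGroup V] [Module F V]

theorem natCard_linearEquiv_of_finrank_eq_three {q : ℕ} (hq : Nat.card F = q)
    (hV : Module.finrank F V = 3) :
    Nat.card (V ≃ₗ[F] V) = (q ^ 3 - 1) * (q ^ 3 - q) * (q ^ 3 - q ^ 2) := by
  have : Module.Finite F V := Module.finite_of_finrank_pos (by omega)
  have : Fintype F := Fintype.ofFinite F
  let B := Module.finBasisOfFinrankEq F V hV
  rw [Nat.card_congr (LinearMap.GeneralLinearGroup.generalLinearEquiv F V).symm.toEquiv,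
    Nat.card_congr (Units.mapEquiv (LinearMap.toMatrixAlgEquiv B).toMulEquiv).toEquiv]
  have := Matrix.card_GL_field (𝔽 := F) 3
  rw [← Nat.card_eq_fintype_card, hq] at this
  rw [show Nat.card (Matrix (Fin 3) (Fin 3) F)ˣ = _ from this, Fin.prod_univ_three]
  simp

theorem exists_containsTransvection_of_two_dvd [CharP F 2] (hV : Module.finrank F V = 3)
    (L : Subgroup (V ≃ₗ[F] V)) (h2 : 2 ∣ Nat.card L) :
    ∃ (φ : V →ₗ[F] F) (u : V), φ ≠ 0 ∧ u ≠ 0 ∧ φ u = 0 ∧ ContainsTransvection L φ u := by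
  have : Module.Finite F V := Module.finite_of_finrank_pos (by omega)
  have : Finite V := Module.finite_of_finite F
  have : Finite (V ≃ₗ[F] V) := Finite.of_injective _ DFunLike.coe_injective
  obtain ⟨⟨t, ht⟩, ho⟩ := exists_prime_orderOf_dvd_card' 2 h2
  rw [Subgroup.orderOf_mk] at ho
  set N : V →ₗ[F] V := (t : V →ₗ[F] V) - LinearMap.id with hN
  have hNv : ∀ v, N v = t v - v := fun v => rfl
  have htt : ∀ v, t (t v) = v := by
    intro v
    have := pow_orderOf_eq_one t
    rw [ho, sq] at this
    rw [← LinearEquiv.mul_apply, this]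
    rfl
  have htwo : ∀ v : V, v + v = 0 := fun v => by
    rw [← two_smul F v, CharTwo.two_eq_zero, zero_smul]
  have hNN : ∀ v, N (N v) = 0 := by
    intro v
    rw [← htwo (v - t v), hNv, hNv, map_sub, htt]
    abel
  obtain ⟨v₀, hv₀⟩ : ∃ v, N v ≠ 0 := by
    by_contra h
    push Not at h
    have : t = 1 := LinearEquiv.ext fun v => sub_eq_zero.1 (h v)
    rw [this, orderOf_one] at ho
    omega
  have hrank : Module.finrank F (LinearMap.range N) ≤ 1 := by
    have h1 := LinearMap.finrank_range_add_finrank_ker N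
    have h2 : LinearMap.range N ≤ LinearMap.ker N := by
      rintro _ ⟨v, rfl⟩
      exact hNN v
    have h3 := Submodule.finrank_mono h2
    omega
  have hspan : ∀ v, ∃ c : F, c • N v₀ = N v := by
    have h1 : Submodule.span F {N v₀} = LinearMap.range N := by
      refine Submodule.eq_of_le_of_finrank_le ?_ ?_
      · rw [Submodule.span_singleton_le_iff_mem]
        exact LinearMap.mem_range_self N v₀
      · rwa [finrank_span_singleton hv₀]
    intro v
    exact Submodule.mem_span_singleton.1 (h1 ▸ LinearMap.mem_range_self N v)
  obtain ⟨f, hf⟩ : ∃ f : V →ₗ[F] F, f (N v₀) ≠ 0 := by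
    by_contra h
    push Not at h
    exact hv₀ ((Module.forall_dual_apply_eq_zero_iff F _).1 h)
  have hφ : ∀ v, ((f (N v₀))⁻¹ • (f ∘ₗ N)) v • N v₀ = N v := by
    intro v
    obtain ⟨c, hc⟩ := hspan v
    rw [← hc, LinearMap.smul_apply, LinearMap.comp_apply, ← hc, map_smul, smul_eq_mul, smul_eq_mul,
      mul_comm c, inv_mul_cancel_left₀ hf]
  refine ⟨(f (N v₀))⁻¹ • (f ∘ₗ N), N v₀, ?_, hv₀, ?_, t, ht, fun v => ?_⟩
  · intro h
    have := hφ v₀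
    rw [h, LinearMap.zero_apply, zero_smul] at this
    exact hv₀ this.symm
  · simp [hNN]
  · rw [hφ, hNv]
    abel

variable {K : Type*} [Field K] [Algebra F K] [Finite K]

theorem exists_containsTransvection_of_eq_four (hq : Nat.card F = 4) (hK : Nat.card K = 4 ^ 2)
    {β : K} (hβ : orderOf β = 5) (L : Subgroup ((F × K) ≃ₗ[F] (F × K))) (h7 : 7 ∣ Nat.card L)
    {b : (F × K) ≃ₗ[F] (F × K)} (hbL : b ∈ L) (hb : ∀ v, b v = (v.1, β * v.2)) :
    ∃ (φ : (F × K) →ₗ[F] F) (u : F × K), φ ≠ 0 ∧ u ≠ 0 ∧ φ u = 0 ∧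
      ContainsTransvection L φ u := by
  obtain ⟨-, hV⟩ := finrank_prod_eq_three hq hK
  have he : ((1 : F), (0 : K)) ≠ 0 := fun h => one_ne_zero (congrArg Prod.fst h)
  have : Finite ((F × K) ≃ₗ[F] (F × K)) := Finite.of_injective _ DFunLike.coe_injective
  by_cases h2 : 2 ∣ Nat.card L
  · have : CharP F 2 := by
      obtain ⟨p, hp⟩ := CharP.exists F
      have hpp : p.Prime := CharP.char_is_prime F p
      have : Fintype F := Fintype.ofFinite F
      have h0 := Nat.cast_card_eq_zero F
      rw [← Nat.card_eq_fintype_card, hq, CharP.cast_eq_zero_iff F p] at h0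
      obtain rfl : p = 2 := (Nat.prime_dvd_prime_iff_eq hpp Nat.prime_two).1
        (hpp.dvd_of_dvd_pow (show p ∣ 2 ^ 2 from h0))
      exact hp
    exact exists_containsTransvection_of_two_dvd hV L h2
  exfalso
  have hcard : Nat.card L ∣ 3 ^ 4 * 5 * 7 := by
    have h1 := Subgroup.card_subgroup_dvd_card L
    rw [natCard_linearEquiv_of_finrank_eq_three hq hV] at h1
    have h3 : Nat.Coprime (Nat.card L) (2 ^ 6) :=
      Nat.Coprime.pow_right 6 ((Nat.Prime.coprime_iff_not_dvd Nat.prime_two).2 h2).symm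
    exact h3.dvd_of_dvd_mul_left (n := 3 ^ 4 * 5 * 7) (by simpa using h1)
  have hp7 : Fact (Nat.Prime 7) := ⟨by norm_num⟩
  obtain ⟨x, hx⟩ := exists_prime_orderOf_dvd_card' 7 h7
  have hpow : ∀ j : ℕ, ∀ v, (b ^ j) v = (v.1, β ^ j * v.2) := by
    intro j
    induction j with
    | zero => intro v; simp
    | succ j ih => intro v; rw [pow_succ, LinearEquiv.mul_apply, ih, hb, pow_succ, mul_assoc]
  have hp5 : Fact (Nat.Prime 5) := ⟨by norm_num⟩
  have hβ1 : β ≠ 1 := fun h => by rw [h, orderOf_one] at hβ; omega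
  have hbo : orderOf (⟨b, hbL⟩ : L) = 5 := by
    rw [Subgroup.orderOf_mk]
    refine orderOf_eq_prime ?_ fun h => hβ1 ?_
    · ext v
      · simp [hpow]
      · simp [hpow, ← hβ, pow_orderOf_eq_one]
    · have := hb (0, 1)
      rw [h] at this
      simpa using (congrArg Prod.snd this).symm
  have hcomm := congrArg Subtype.val (commute_of_orderOf_eq_seven_five hcard hx hbo).eq
  have hbx : b (x.1 (1, 0)) = x.1 (1, 0) := by
    have := LinearEquiv.congr_fun hcomm (1, 0)
    change x.1 (b (1, 0)) = b (x.1 (1, 0)) at this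
    rw [← this, hb]
    simp
  have hsnd : (x.1 (1, 0)).2 = 0 := by
    have h1 := congrArg Prod.snd (hbx.symm.trans (hb _))
    have h3 : (β - 1) * (x.1 (1, 0)).2 = 0 := by
      rw [sub_mul, one_mul, sub_eq_zero]
      exact h1.symm
    exact (mul_eq_zero.1 h3).resolve_left (sub_ne_zero.2 hβ1)
  set c := (x.1 (1, 0)).1 with hc
  have hxe : x.1 (1, 0) = c • ((1 : F), (0 : K)) := by
    ext
    · simp [hc]
    · simp [hsnd]
  have hxpow : ∀ j : ℕ, (x.1 ^ j) (1, 0) = c ^ j • ((1 : F), (0 : K)) := by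
    intro j
    induction j with
    | zero => simp
    | succ j ih => rw [pow_succ', LinearEquiv.mul_apply, ih, map_smul, hxe, smul_smul, pow_succ]
  have hxo : orderOf x.1 = 7 := by rw [Subgroup.orderOf_coe, hx]
  have hc7 : c ^ 7 = 1 := by
    have := hxpow 7
    rw [← hxo, pow_orderOf_eq_one, hxo] at this
    simpa using (congrArg Prod.fst this).symm
  have hc3 : c ^ 3 = 1 := by
    have : Fintype F := Fintype.ofFinite F
    have h1 := FiniteField.pow_card_sub_one_eq_one c (fun h => by rw [h] at hc7; simp at hc7)
    rwa [← Nat.card_eq_fintype_card, hq] at h1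
  have hc1 : c = 1 := by
    calc c = c ^ 7 := by rw [show (7 : ℕ) = 3 + 3 + 1 by rfl, pow_succ, pow_add, hc3]; simp
      _ = 1 := hc7
  rw [hc1, one_smul] at hxe
  have := dvd_of_orderOf_prime_of_fixed hq hV hp7.out x.1 hxo he hxe
  omega

end CardFour

/-! ### A normal form for the element of order `(q² - 1) / d` -/

section NormalForm

universe u v

variable {F : Type u} {V : Type v} [Field F] [AddCommGroup V] [Module F V]

theorem exists_field_linearEquiv_of_no_eigenvector (hV : 2 ≤ Module.finrank F V)
    (hV' : Module.finrank F V ≤ 3) (g : Module.End F V)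
    (hg : ∀ (c : F) (v : V), g v = c • v → v = 0) :
    ∃ (K : Type u) (_ : Field K) (_ : Algebra F K) (α : K) (e : V ≃ₗ[F] K),
      ∀ v, e (g v) = α * e v := by
  have : Module.Finite F V := Module.finite_of_finrank_pos (by omega)
  have hdeg : g.charpoly.natDegree = Module.finrank F V := LinearMap.charpoly_natDegree g
  have hirr : Irreducible g.charpoly := by
    rw [Polynomial.irreducible_iff_roots_eq_zero_of_degree_le_three (by omega) (by omega),
      Multiset.eq_zero_iff_forall_notMem]
    intro c hc
    have h1 := (Module.End.hasEigenvalue_iff_isRoot_charpoly g c).2 (Polynomial.isRoot_of_mem_roots hc)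
    obtain ⟨v, hv⟩ := h1.exists_hasEigenvector
    exact hv.2 (hg c v hv.apply_eq_smul)
  have hfact : Fact (Irreducible g.charpoly) := ⟨hirr⟩
  have hne : g.charpoly ≠ 0 := hirr.ne_zero
  obtain ⟨w, hw⟩ : ∃ w : V, w ≠ 0 := by
    have : Nontrivial V := Module.nontrivial_of_finrank_pos (R := F) (by omega)
    exact exists_ne 0
  let ρ : AdjoinRoot g.charpoly →+* Module.End F V :=
    Ideal.Quotient.lift (Ideal.span {g.charpoly}) (Polynomial.aeval g).toRingHom (by
      intro p hp
      obtain ⟨r, rfl⟩ := Ideal.mem_span_singleton.1 hp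
      rw [AlgHom.toRingHom_eq_coe, RingHom.coe_coe, map_mul, LinearMap.aeval_self_charpoly,
        zero_mul])
  have hρ : ∀ p, ρ (AdjoinRoot.mk _ p) = Polynomial.aeval g p := fun _ => rfl
  have hρg : ρ (AdjoinRoot.root _) = g := (hρ Polynomial.X).trans (Polynomial.aeval_X g)
  let T : AdjoinRoot g.charpoly →ₗ[F] V :=
    { toFun := fun x => ρ x w
      map_add' := fun x y => by rw [map_add, LinearMap.add_apply]
      map_smul' := fun c x => by
        obtain ⟨p, rfl⟩ := AdjoinRoot.mk_surjective x
        rw [AdjoinRoot.smul_mk, hρ, hρ, map_smul, LinearMap.smul_apply, RingHom.id_apply] }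
  have hT : ∀ x, T x = ρ x w := fun _ => rfl
  have hinj : Function.Injective T := by
    rw [injective_iff_map_eq_zero]
    intro x hx
    by_contra hx0
    apply hw
    have h1 : ρ (x⁻¹ * x) w = 0 := by
      rw [map_mul, Module.End.mul_apply, ← hT x, hx, map_zero]
    rwa [inv_mul_cancel₀ hx0, map_one] at h1
  have hfin : Module.finrank F (AdjoinRoot g.charpoly) = Module.finrank F V := by
    rw [(AdjoinRoot.powerBasis hne).finrank, AdjoinRoot.powerBasis_dim, hdeg]
  have : Module.Finite F (AdjoinRoot g.charpoly) := (AdjoinRoot.powerBasis hne).finite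
  refine ⟨AdjoinRoot g.charpoly, inferInstance, inferInstance, AdjoinRoot.root _,
    (LinearEquiv.ofInjectiveOfFinrankEq T hinj hfin).symm, fun v => ?_⟩
  obtain ⟨x, rfl⟩ := (LinearEquiv.ofInjectiveOfFinrankEq T hinj hfin).surjective v
  rw [LinearEquiv.symm_apply_eq, LinearEquiv.symm_apply_apply]
  change g (ρ x w) = ρ (AdjoinRoot.root _ * x) w
  rw [map_mul, hρg, Module.End.mul_apply]

variable [Finite F]

theorem exists_normal_form {q N : ℕ} (hq : Nat.card F = q) (hq2 : 2 < q)
    (hV : Module.finrank F V = 3) (f : Module.End F V)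
    (hN : Nat.gcd 3 (q - 1) * N = q ^ 2 - 1) (hf : f ^ (q ^ 2 - 1) = 1)
    (hfN : ∀ k, (∃ c : F, ∀ v, (f ^ k) v = c • v) ↔ N ∣ k) :
    ∃ (K : Type u) (_ : Field K) (_ : Algebra F K) (β : K) (c : F) (e : V ≃ₗ[F] F × K),
      Nat.card K = q ^ 2 ∧ β ≠ 0 ∧ c ≠ 0 ∧ orderOf β = N ∧
      ∀ v, e (f v) = c • ((e v).1, β * (e v).2) := by
  have : Module.Finite F V := Module.finite_of_finrank_pos (by omega)
  have hq1 : 1 ≤ q := by omega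
  have hsq : 1 ≤ q ^ 2 := Nat.one_le_pow _ _ hq1
  have hfinj : ∀ v, f v = 0 → v = 0 := by
    intro v hv
    have h1 : (f ^ (q ^ 2 - 1)) v = 0 := by
      rw [show q ^ 2 - 1 = (q ^ 2 - 1 - 1) + 1 by
        have : 3 * 3 ≤ q ^ 2 := by nlinarith
        omega, pow_succ, Module.End.mul_apply, hv, map_zero]
    rwa [hf] at h1
  have hFpow : ∀ c : F, c ≠ 0 → c ^ (q - 1) = 1 := by
    intro c hc
    have : Fintype F := Fintype.ofFinite F
    have h1 := FiniteField.pow_card_sub_one_eq_one c hc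
    rwa [← Nat.card_eq_fintype_card, hq] at h1
  have heig : ∀ (c : F) (v : V), f v = c • v → ∀ k, (f ^ k) v = c ^ k • v := by
    intro c v hv k
    induction k with
    | zero => simp
    | succ k ih => rw [pow_succ, Module.End.mul_apply, hv, map_smul, ih, smul_smul, pow_succ']
  obtain ⟨c₀, v₀, hv₀, hcv⟩ : ∃ (c : F) (v : V), v ≠ 0 ∧ f v = c • v := by
    by_contra hcon
    push Not at hcon
    have hno : ∀ (c : F) (v : V), f v = c • v → v = 0 := fun c v h => by
      by_contra hv
      exact hcon c v hv h
    obtain ⟨K, _, _, α, e, he⟩ :=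
      exists_field_linearEquiv_of_no_eigenvector (by omega) (by omega) f hno
    have hpow : ∀ k v, e ((f ^ k) v) = α ^ k * e v := by
      intro k
      induction k with
      | zero => simp
      | succ k ih => intro v; rw [pow_succ', Module.End.mul_apply, he, ih, pow_succ', mul_assoc]
    have h1 : α ^ (q ^ 2 - 1) = 1 := by
      have := hpow (q ^ 2 - 1) (e.symm 1)
      rw [hf, Module.End.one_apply, e.apply_symm_apply, mul_one] at this
      exact this.symm
    have hKfin : Module.Finite F K := Module.Finite.equiv e
    have : Finite K := Module.finite_of_finite F
    have hcK : Nat.card K = q ^ 3 := by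
      rw [Module.natCard_eq_pow_finrank (K := F), ← e.finrank_eq, hV, hq]
    have hα0 : α ≠ 0 := by
      rintro rfl
      rw [zero_pow] at h1
      · exact zero_ne_one h1
      · have : 3 * 3 ≤ q ^ 2 := by nlinarith
        omega
    have h2 : α ^ (q ^ 3 - 1) = 1 := by
      have : Fintype K := Fintype.ofFinite K
      rw [← hcK, Nat.card_eq_fintype_card]
      exact FiniteField.pow_card_sub_one_eq_one α hα0
    have h3 : α ^ q = α := by
      have h4 : q ^ 3 - 1 = q * (q ^ 2 - 1) + (q - 1) := by
        obtain ⟨t, ht⟩ := Nat.exists_eq_add_of_le hsq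
        rw [ht, Nat.add_sub_cancel_left, show q ^ 3 = q * q ^ 2 by ring, ht, mul_add, mul_one]
        omega
      rw [h4, pow_add, mul_comm q, pow_mul, h1, one_pow, one_mul] at h2
      calc α ^ q = α ^ (q - 1) * α := by rw [← pow_succ, Nat.sub_add_cancel hq1]
        _ = α := by rw [h2, one_mul]
    obtain ⟨a, ha⟩ := exists_algebraMap_eq_of_pow_card (F := F) (x := α) (by rw [hq, h3])
    refine one_ne_zero (α := K) (e.symm.map_eq_zero_iff.1 (hno a (e.symm 1) ?_))
    apply e.injective
    rw [he, map_smul, e.apply_symm_apply, ← ha, Algebra.smul_def]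
  have hss : f.IsSemisimple := by
    refine Module.End.isSemisimple_of_squarefree_aeval_eq_zero
      (p := Polynomial.X ^ (q ^ 2 - 1) - 1) ?_ (by simp [hf])
    apply Polynomial.Separable.squarefree
    rw [Polynomial.X_pow_sub_one_separable_iff]
    have : Fintype F := Fintype.ofFinite F
    have h0 := Nat.cast_card_eq_zero F
    rw [← Nat.card_eq_fintype_card, hq] at h0
    rw [Nat.cast_sub hsq, Nat.cast_pow, h0]
    simp
  set E : Submodule F V := LinearMap.ker (f ^ (q - 1) - 1) with hE
  have hmemE : ∀ v, v ∈ E ↔ (f ^ (q - 1)) v = v := by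
    intro v
    rw [hE, LinearMap.mem_ker, LinearMap.sub_apply, sub_eq_zero, Module.End.one_apply]
  have hEf : ∀ v ∈ E, f v ∈ E := by
    intro v hv
    rw [hmemE] at hv ⊢
    rw [← Module.End.mul_apply, ← pow_succ, pow_succ', Module.End.mul_apply, hv]
  have hEtop : E ≠ ⊤ := by
    intro h
    have h1 : N ∣ q - 1 := (hfN _).1 ⟨1, fun v => by
      rw [one_smul, ← hmemE, h]; trivial⟩
    have h2 := Nat.le_of_dvd (by omega) h1
    rw [sq_sub_one_eq] at hN
    obtain ⟨m, rfl⟩ := Nat.exists_eq_add_of_le' hq1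
    rw [Nat.add_sub_cancel] at hN h2
    rcases gcd_three_eq_one_or_three m with hd | hd <;> rw [hd] at hN <;> nlinarith
  have hv₀E : ∀ (c : F) (v : V), v ≠ 0 → f v = c • v → v ∈ E := by
    intro c v hv hcv
    have hc : c ≠ 0 := fun h => hv (hfinj v (by rw [hcv, h, zero_smul]))
    rw [hmemE, heig c v hcv, hFpow c hc, one_smul]
  obtain ⟨U, hUf, hEU⟩ := Module.End.isSemisimple_iff.1 hss E hEf
  have hUno : ∀ (c : F) (v : V), v ∈ U → f v = c • v → v = 0 := by
    intro c v hvU hcv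
    by_contra hv
    exact hv ((Submodule.disjoint_def.1 hEU.disjoint) v (hv₀E c v hv hcv) hvU)
  have hsum : Module.finrank F E + Module.finrank F U = 3 := by
    rw [Submodule.finrank_add_eq_of_isCompl hEU, hV]
  have hE1 : 1 ≤ Module.finrank F E := by
    rw [Nat.one_le_iff_ne_zero, Ne, Submodule.finrank_eq_zero]
    intro h
    exact hv₀ ((Submodule.mem_bot F).1 (h ▸ hv₀E c₀ v₀ hv₀ hcv))
  have hU0 : Module.finrank F U ≠ 0 := by
    rw [Ne, Submodule.finrank_eq_zero]
    rintro rfl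
    exact hEtop (by simpa using hEU.sup_eq_top)
  have hU1 : Module.finrank F U ≠ 1 := by
    intro h
    obtain ⟨⟨u, hu⟩, hu0, hspan⟩ := finrank_eq_one_iff'.1 h
    obtain ⟨c, hc⟩ := hspan ⟨f u, hUf hu⟩
    exact hu0 (Subtype.ext (hUno c u hu (congrArg Subtype.val hc).symm))
  have hE1' : Module.finrank F E = Module.finrank F F := by
    rw [Module.finrank_self]; omega
  let g : Module.End F U := f.restrict hUf
  obtain ⟨K, _, _, α, e₂, he₂⟩ :=
    exists_field_linearEquiv_of_no_eigenvector (by omega) (by omega) g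
      (fun c v h => Subtype.ext (hUno c v v.2 (congrArg Subtype.val h)))
  let e₁ : E ≃ₗ[F] F := LinearEquiv.ofFinrankEq E F hE1'
  let g₁ : Module.End F E := f.restrict hEf
  set c := e₁ (g₁ (e₁.symm 1)) with hc
  have he₁ : ∀ x, e₁ (g₁ x) = c * e₁ x := by
    intro x
    have : x = e₁ x • e₁.symm 1 := e₁.injective (by simp)
    rw [this]
    simp only [map_smul, smul_eq_mul, e₁.apply_symm_apply, mul_one, ← hc]
    rw [mul_comm]
  let e : V ≃ₗ[F] F × K := (Submodule.prodEquivOfIsCompl E U hEU).symm.trans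
    (e₁.prodCongr e₂)
  have he : ∀ v, e (f v) = (c * (e v).1, α * (e v).2) := by
    intro v
    obtain ⟨⟨x, u⟩, rfl⟩ := (Submodule.prodEquivOfIsCompl E U hEU).surjective v
    have h1 : f (Submodule.prodEquivOfIsCompl E U hEU (x, u)) =
        Submodule.prodEquivOfIsCompl E U hEU (g₁ x, g u) := by
      simp [g₁, g]
      rfl
    rw [h1]
    simp [e, he₁, he₂]
  have hpow : ∀ k v, e ((f ^ k) v) = (c ^ k * (e v).1, α ^ k * (e v).2) := by
    intro k
    induction k with
    | zero => simp
    | succ k ih => intro v; rw [pow_succ', Module.End.mul_apply, he, ih, pow_succ', pow_succ',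
                    mul_assoc, mul_assoc]
  have hc0 : c ≠ 0 := by
    intro h
    have h1 := hfinj (e.symm (1, 0)) (e.map_eq_zero_iff.1 (by rw [he, e.apply_symm_apply, h]; simp))
    exact one_ne_zero (congrArg Prod.fst (e.symm.map_eq_zero_iff.1 h1))
  have hα0 : α ≠ 0 := by
    intro h
    have h1 := hfinj (e.symm (0, 1)) (e.map_eq_zero_iff.1 (by rw [he, e.apply_symm_apply, h]; simp))
    exact one_ne_zero (congrArg Prod.snd (e.symm.map_eq_zero_iff.1 h1))
  have hca : algebraMap F K c ≠ 0 := (map_ne_zero _).2 hc0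
  refine ⟨K, inferInstance, inferInstance, (algebraMap F K c)⁻¹ * α, c, e, ?_,
    mul_ne_zero (inv_ne_zero hca) hα0, hc0, ?_, fun v => ?_⟩
  · have : Module.Finite F K := Module.Finite.equiv e₂
    rw [Module.natCard_eq_pow_finrank (K := F), ← e₂.finrank_eq, hq]
    congr 1
    omega
  · apply Nat.dvd_antisymm
    · obtain ⟨s, hs⟩ := (hfN N).2 dvd_rfl
      have h1 := hpow N (e.symm (1, 1))
      rw [hs, map_smul, e.apply_symm_apply] at h1
      have h2 : s = c ^ N := by simpa using congrArg Prod.fst h1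
      have h3 : algebraMap F K s = α ^ N := by
        simpa [Algebra.smul_def] using congrArg Prod.snd h1
      rw [orderOf_dvd_iff_pow_eq_one, mul_pow, ← h3, h2, map_pow, ← mul_pow,
        inv_mul_cancel₀ hca, one_pow]
    · rw [← hfN]
      have h1 := pow_orderOf_eq_one ((algebraMap F K c)⁻¹ * α)
      set k := orderOf ((algebraMap F K c)⁻¹ * α)
      refine ⟨c ^ k, fun v => e.injective ?_⟩
      have h2 : α ^ k = algebraMap F K (c ^ k) := by
        rw [mul_pow, inv_pow, inv_mul_eq_iff_eq_mul₀ (pow_ne_zero _ hca), mul_one] at h1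
        rw [h1, map_pow]
      rw [hpow, map_smul, h2, ← Algebra.smul_def]
      rfl
  · rw [he]
    refine Prod.ext rfl ?_
    change α * _ = c • ((algebraMap F K c)⁻¹ * α * _)
    rw [Algebra.smul_def, mul_assoc, mul_inv_cancel_left₀ hca]

end NormalForm

/-! ### From transvections to the whole group -/

section Generation

open Matrix Matrix.SpecialLinearGroup

variable {F : Type*} [Field F]

set_option maxHeartbeats 2000000 in
theorem diag2n_eq_transvection_mul {i j : Fin 3} (hij : i ≠ j) (c : F) (hc : c ≠ 0) :
    diag2n hij c hc = transvection hij c * transvection hij.symm (-c⁻¹) * transvection hij c *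
      (transvection hij (-1) * transvection hij.symm 1 * transvection hij (-1)) := by
  ext k l
  simp only [coe_mul, diag2n_coe, transvection_coe, mul_apply, Fin.sum_univ_three]
  fin_cases i <;> fin_cases j <;> first | exact absurd rfl hij | skip
  all_goals fin_cases k <;> fin_cases l <;> simp [one_apply, hc]

theorem specialLinearGroup_eq_top_of_transvection_mem (H : Subgroup SL(3, F))
    (h : ∀ (i j : Fin 3) (hij : i ≠ j) (c : F), transvection hij c ∈ H) : H = ⊤ := by
  refine (Subgroup.eq_top_iff' H).2 fun A => ?_
  refine diagonal_transvection_induction' (· ∈ H) A (fun i j hij c hc => ?_) h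
    fun _ _ => H.mul_mem
  rw [diag2n_eq_transvection_mul]
  exact H.mul_mem (H.mul_mem (H.mul_mem (h ..) (h ..)) (h ..))
    (H.mul_mem (H.mul_mem (h ..) (h ..)) (h ..))

end Generation

section ScalarExtension

open Matrix Matrix.SpecialLinearGroup

variable {F W : Type*} [Field F] [AddCommGroup W] [Module F W]

/-- The linear automorphisms of `W` that are proportional to an element of `H`, transported along
the linear equivalence `e`. -/
def scalarExtension {n : Type*} [Fintype n] [DecidableEq n] (H : Subgroup (SpecialLinearGroup n F))
    (e : (n → F) ≃ₗ[F] W) : Subgroup (W ≃ₗ[F] W) where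
  carrier := {g | ∃ c : F, c ≠ 0 ∧ ∃ m ∈ H, ∀ v, g (e v) = c • e (SpecialLinearGroup.toLin' m v)}
  one_mem' := ⟨1, one_ne_zero, 1, H.one_mem, fun v => by simp⟩
  mul_mem' := by
    rintro g₁ g₂ ⟨c₁, hc₁, m₁, hm₁, h₁⟩ ⟨c₂, hc₂, m₂, hm₂, h₂⟩
    refine ⟨c₁ * c₂, mul_ne_zero hc₁ hc₂, m₁ * m₂, H.mul_mem hm₁ hm₂, fun v => ?_⟩
    rw [LinearEquiv.mul_apply, h₂, map_smul, h₁, map_mul, LinearEquiv.mul_apply, smul_smul,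
      mul_comm c₁]
  inv_mem' := by
    rintro g ⟨c, hc, m, hm, h⟩
    refine ⟨c⁻¹, inv_ne_zero hc, m⁻¹, H.inv_mem hm, fun v => g.injective ?_⟩
    have h1 : g (g⁻¹ (e v)) = e v := g.apply_symm_apply (e v)
    rw [h1, map_smul, h, smul_smul, inv_mul_cancel₀ hc, one_smul, ← LinearEquiv.mul_apply,
      ← map_mul, mul_inv_cancel, map_one]
    rfl

theorem exists_toLin'_eq_smul_iff (A : SL(3, F)) :
    (∃ c : F, ∀ v, SpecialLinearGroup.toLin' A v = c • v) ↔ A ∈ Subgroup.center SL(3, F) := by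
  rw [mem_center_iff]
  constructor
  · rintro ⟨c, hc⟩
    have h1 : scalar (Fin 3) c = A := by
      apply Matrix.toLin'.injective
      ext1 i
      ext1
      ext1 j
      have := congrFun (hc (Pi.single i 1)) j
      rw [SpecialLinearGroup.toLin'_apply, Matrix.toLin'_apply] at this
      simpa [Matrix.diagonal_apply, Pi.single_apply, mul_comm] using this.symm
    refine ⟨c, ?_, h1⟩
    have h2 := A.det_coe
    rw [← h1] at h2
    simpa [Matrix.scalar_apply] using h2
  · rintro ⟨c, -, hc⟩
    refine ⟨c, fun v => ?_⟩
    rw [SpecialLinearGroup.toLin'_apply, Matrix.toLin'_apply, ← hc]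
    ext i
    simp [Matrix.mulVec_diagonal]

theorem exists_toLin'_pow_eq_smul_iff (A : SL(3, F)) (k : ℕ) :
    (∃ c : F, ∀ v, (SpecialLinearGroup.toLin' A ^ k) v = c • v) ↔
      orderOf (QuotientGroup.mk A : PSL(3, F)) ∣ k := by
  rw [← map_pow, exists_toLin'_eq_smul_iff, orderOf_dvd_iff_pow_eq_one, ← QuotientGroup.mk_pow,
    QuotientGroup.eq_one_iff]

theorem pow_eq_one_of_orderOf_mk [Finite F] {q N : ℕ} (hq : Nat.card F = q) (B : SL(3, F))
    (hN : Nat.gcd 3 (q - 1) * N = q ^ 2 - 1)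
    (hB : orderOf (QuotientGroup.mk B : PSL(3, F)) = N) : B ^ (q ^ 2 - 1) = 1 := by
  have h1 : B ^ N ∈ Subgroup.center SL(3, F) := by
    rw [← QuotientGroup.eq_one_iff, QuotientGroup.mk_pow, ← hB, pow_orderOf_eq_one]
  obtain ⟨r, hr, hrB⟩ := mem_center_iff.1 h1
  rw [Fintype.card_fin] at hr
  have hr0 : r ≠ 0 := by
    rintro rfl
    rw [zero_pow three_ne_zero] at hr
    exact zero_ne_one hr
  have : Fintype F := Fintype.ofFinite F
  have h2 : r ^ (q - 1) = 1 := by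
    rw [← hq, Nat.card_eq_fintype_card]
    exact FiniteField.pow_card_sub_one_eq_one r hr0
  apply coeMonoidHom_injective
  rw [← hN, mul_comm, pow_mul, map_pow, coeMonoidHom_apply, ← hrB, ← map_pow,
    pow_gcd_eq_one.2 ⟨hr, h2⟩, map_one, map_one]

theorem transvection_mem_of_containsTransvection {H : Subgroup SL(3, F)}
    (hH : Subgroup.center SL(3, F) ≤ H) (e : (Fin 3 → F) ≃ₗ[F] W)
    (h : ∀ (φ : W →ₗ[F] F) (u : W), φ u = 0 → ContainsTransvection (scalarExtension H e) φ u)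
    {i j : Fin 3} (hij : i ≠ j) (c : F) : transvection hij c ∈ H := by
  obtain ⟨g, ⟨s, hs, m, hm, hgm⟩, hg⟩ :=
    h (LinearMap.proj j ∘ₗ (e.symm : W →ₗ[F] Fin 3 → F)) (e (c • Pi.single i 1)) (by simp [hij.symm])
  have h1 : ∀ v, SpecialLinearGroup.toLin' (transvection hij c) v =
      s • SpecialLinearGroup.toLin' m v := by
    intro v
    apply e.injective
    rw [map_smul, ← hgm, hg, ← map_smul, ← map_add]
    congr 1
    rw [SpecialLinearGroup.toLin'_apply, Matrix.toLin'_apply, transvection_coe, add_mulVec,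
      one_mulVec]
    congr 1
    ext k
    simp [single_mulVec, Pi.single_apply, Function.update_apply, mul_comm]
  have h2 : m⁻¹ * transvection hij c ∈ Subgroup.center SL(3, F) := by
    rw [← exists_toLin'_eq_smul_iff]
    refine ⟨s, fun v => ?_⟩
    rw [map_mul, LinearEquiv.mul_apply, h1, map_smul, ← LinearEquiv.mul_apply, ← map_mul,
      inv_mul_cancel, map_one]
    rfl
  have h3 := H.mul_mem hm (hH h2)
  rwa [mul_inv_cancel_left] at h3

end ScalarExtension

/-- For `q > 2` and `d = gcd(3, q−1)`, any subgroup of `PSL₃(F_q)` containing an element of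
order `(q² + q + 1)/d` and an element of order `(q² − 1)/d` is the whole group. -/
theorem psl3_subgroup_eq_top_of_orders (F : Type*) [Field F] [Fintype F]
    (hq : 2 < Fintype.card F) (M : Subgroup PSL(3, F))
    (h1 : ∃ x ∈ M, orderOf x =
      (Fintype.card F ^ 2 + Fintype.card F + 1) / Nat.gcd 3 (Fintype.card F - 1))
    (h2 : ∃ y ∈ M, orderOf y =
      (Fintype.card F ^ 2 - 1) / Nat.gcd 3 (Fintype.card F - 1)) :
    M = ⊤ := by
  have hF : Nat.card F = Fintype.card F := Nat.card_eq_fintype_card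
  generalize Fintype.card F = q at *
  obtain ⟨x, hxM, hx⟩ := h1
  obtain ⟨y, hyM, hy⟩ := h2
  have hn : Nat.gcd 3 (q - 1) * orderOf x = q ^ 2 + q + 1 := by
    rw [hx, Nat.mul_div_cancel' (gcd_three_pred_dvd q (by omega))]
  have hN : Nat.gcd 3 (q - 1) * orderOf y = q ^ 2 - 1 := by
    rw [hy, Nat.mul_div_cancel' (gcd_three_pred_dvd_sq_sub_one q)]
  clear hx hy
  obtain ⟨A, rfl⟩ := QuotientGroup.mk_surjective x
  obtain ⟨B, rfl⟩ := QuotientGroup.mk_surjective y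
  have hpow : ∀ k v, (Matrix.toLin' (B : Matrix (Fin 3) (Fin 3) F) ^ k) v =
      (Matrix.SpecialLinearGroup.toLin' B ^ k) v := by
    intro k v
    rw [← map_pow Matrix.SpecialLinearGroup.toLin', ← Matrix.toLin'_pow,
      Matrix.SpecialLinearGroup.toLin'_apply, Matrix.SpecialLinearGroup.coe_pow]
  obtain ⟨K, _, _, β, c, e, hK, hβ0, hc, hβ, he⟩ :=
    exists_normal_form hF hq (V := Fin 3 → F) (by simp) (Matrix.toLin' (B : Matrix (Fin 3) (Fin 3) F)) hN
      (by rw [← Matrix.toLin'_pow, ← Matrix.SpecialLinearGroup.coe_pow,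
            pow_eq_one_of_orderOf_mk hF B hN rfl, Matrix.SpecialLinearGroup.coe_one,
            Matrix.toLin'_one]; rfl)
      (fun k => by simp_rw [hpow]; exact exists_toLin'_pow_eq_smul_iff B k)
  have : Finite K := Nat.finite_of_card_ne_zero (by rw [hK]; positivity)
  rw [← hβ] at hN
  set H : Subgroup SL(3, F) := M.comap (QuotientGroup.mk' _) with hH
  have hcen : Subgroup.center SL(3, F) ≤ H := by
    intro z hz
    rw [hH, Subgroup.mem_comap, QuotientGroup.mk'_apply, (QuotientGroup.eq_one_iff z).2 hz]
    exact M.one_mem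
  set L := scalarExtension H e with hL
  have hs : ∀ c : F, c ≠ 0 → ∃ g ∈ L, ∀ v, g v = c • v := fun c hc =>
    ⟨LinearEquiv.smulOfNeZero F (F × K) c hc, ⟨c, hc, 1, H.one_mem, fun v => by simp⟩,
      fun v => rfl⟩
  let b : (F × K) ≃ₗ[F] (F × K) := e.symm ≪≫ₗ Matrix.SpecialLinearGroup.toLin' B ≪≫ₗ e ≪≫ₗ
    LinearEquiv.smulOfNeZero F (F × K) c⁻¹ (inv_ne_zero hc)
  have hbe : ∀ v, b (e v) = c⁻¹ • e (Matrix.SpecialLinearGroup.toLin' B v) := fun v => by simp [b]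
  have hbL : b ∈ L := ⟨c⁻¹, inv_ne_zero hc, B, hyM, hbe⟩
  have hb : ∀ v, b v = (v.1, β * v.2) := by
    intro v
    obtain ⟨v, rfl⟩ := e.surjective v
    rw [hbe, Matrix.SpecialLinearGroup.toLin'_apply, he, smul_smul, inv_mul_cancel₀ hc, one_smul]
  let a : (F × K) ≃ₗ[F] (F × K) := e.symm ≪≫ₗ Matrix.SpecialLinearGroup.toLin' A ≪≫ₗ e
  have hae : ∀ v, a (e v) = e (Matrix.SpecialLinearGroup.toLin' A v) := fun v => by simp [a]
  have haL : a ∈ L := ⟨1, one_ne_zero, A, hxM, fun v => by rw [one_smul, hae]⟩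
  have hapow : ∀ k v, (a ^ k) (e v) = e ((Matrix.SpecialLinearGroup.toLin' A ^ k) v) := by
    intro k
    induction k with
    | zero => intro v; rfl
    | succ k ih => intro v; rw [pow_succ, pow_succ, LinearEquiv.mul_apply, hae, ih,
                    LinearEquiv.mul_apply]
  have ha : ∀ k, (∃ c : F, ∀ v, (a ^ k) v = c • v) →
      orderOf (QuotientGroup.mk A : PSL(3, F)) ∣ k := by
    rintro k ⟨c, hc⟩
    rw [← exists_toLin'_pow_eq_smul_iff]
    exact ⟨c, fun v => e.injective (by rw [← hapow, hc, map_smul])⟩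
  have htrans : ∀ u v : F × K, u ≠ 0 → v ≠ 0 → ∃ g ∈ L, g u = v := fun u v hu hv =>
    transitive_of_orders hF hq hK hn hN hβ0 L hs hbL hb haL ha hu hv
  obtain ⟨φ₀, u₀, hφ₀, hu₀, h0, hφ⟩ : ∃ (φ : (F × K) →ₗ[F] F) (u : F × K), φ ≠ 0 ∧ u ≠ 0 ∧
      φ u = 0 ∧ ContainsTransvection L φ u := by
    rcases eq_or_ne q 4 with rfl | hq4
    · have h7 : orderOf (QuotientGroup.mk A : PSL(3, F)) ∣ Nat.card L := by
        refine (ha (orderOf a) ⟨1, fun v => by simp [pow_orderOf_eq_one]⟩).trans ?_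
        rw [← Subgroup.orderOf_mk a haL]
        exact orderOf_dvd_natCard _
      norm_num at hn hN
      refine exists_containsTransvection_of_eq_four hF hK (by omega) L ?_ hbL hb
      rwa [show orderOf (QuotientGroup.mk A : PSL(3, F)) = 7 by omega] at h7
    · exact exists_containsTransvection_of_ne_four hF hq hq4 hK hN hβ0 L hs htrans hbL hb
  have htop : H = ⊤ := specialLinearGroup_eq_top_of_transvection_mem H fun i j hij c =>
    transvection_mem_of_containsTransvection hcen e
      (containsTransvection_of_transitive hF hq hK hN hβ0 L htrans hbL hb hφ₀ hu₀ h0 hφ) hij c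
  rw [eq_top_iff]
  rintro z -
  obtain ⟨Z, rfl⟩ := QuotientGroup.mk_surjective z
  have hZ : Z ∈ H := htop ▸ Subgroup.mem_top Z
  exact hZ
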